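/- arXiv:1009.3214 — 9 statements merged into one kernel-verified Lean document; each statement's English description precedes it below -/
import Mathlib

section
/- Let f ∈ ℚ[x] be irreducible of degree d ≥ 2, and suppose there exist a positive integer m and r ∈ ℚ such that f divides x^m − r. Then the least such m satisfies m ≤ d·(⌈3d·ln(ln d)⌉ + 7). -/
/-- The `T.card` elements of a set of odd numbers `≥ 3` dominate `3, 5, 7, …`. -/
theorem card_lt_of_odd {T : Finset ℕ} {a : ℕ} (hT : ∀ p ∈ T, Odd p ∧ 3 ≤ p) (ha : Odd a)
    (h : ∀ p ∈ T, p < a) (ha3 : 3 ≤ a) : 2 * T.card + 3 ≤ a := by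
  have h1 : T.card ≤ (Finset.Icc 1 ((a - 3) / 2)).card := by
    refine Finset.card_le_card_of_injOn (fun p => (p - 1) / 2) ?_ ?_
    · intro p hp
      obtain ⟨⟨k, hk⟩, h3⟩ := hT p hp
      obtain ⟨l, hl⟩ := ha
      have := h p hp
      simp only [Finset.coe_Icc, Set.mem_Icc]
      omega
    · intro p hp q hq hpq
      obtain ⟨⟨k, hk⟩, h3⟩ := hT p hp
      obtain ⟨⟨l, hl⟩, h3⟩ := hT q hq
      simp only at hpq
      omega
  rw [Nat.card_Icc] at h1
  obtain ⟨l, hl⟩ := ha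
  omega

theorem two_pow_mul_factorial_le_prod (S : Finset ℕ) (hS : ∀ p ∈ S, Odd p ∧ 3 ≤ p) :
    2 ^ S.card * S.card.factorial ≤ ∏ p ∈ S, (p - 1) := by
  induction S using Finset.induction_on_max with
  | empty => simp
  | insert a T h ih =>
    have ha : a ∉ T := fun h' => lt_irrefl _ (h a h')
    have hT : ∀ p ∈ T, Odd p ∧ 3 ≤ p := fun p hp => hS p (Finset.mem_insert_of_mem hp)
    have haS := hS a (Finset.mem_insert_self a T)
    have hc := card_lt_of_odd hT haS.1 h haS.2
    rw [Finset.prod_insert ha, Finset.card_insert_of_notMem ha, Nat.factorial_succ]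
    calc _ = (2 * (T.card + 1)) * (2 ^ T.card * T.card.factorial) := by ring
      _ ≤ _ := Nat.mul_le_mul (by omega) (ih hT)

theorem prod_div_sub_one_le (S : Finset ℕ) (hS : ∀ p ∈ S, Odd p ∧ 3 ≤ p) :
    ∏ p ∈ S, ((p : ℝ) / (p - 1)) ≤ ∏ i ∈ Finset.range S.card, (1 + 1 / (2 * ((i : ℝ) + 1))) := by
  induction S using Finset.induction_on_max with
  | empty => simp
  | insert a T h ih =>
    have ha : a ∉ T := fun h' => lt_irrefl _ (h a h')
    have hT : ∀ p ∈ T, Odd p ∧ 3 ≤ p := fun p hp => hS p (Finset.mem_insert_of_mem hp)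
    have haS := hS a (Finset.mem_insert_self a T)
    have hc : (2 * (T.card : ℝ) + 3) ≤ a := by exact_mod_cast card_lt_of_odd hT haS.1 h haS.2
    have hc0 : (0 : ℝ) ≤ T.card := Nat.cast_nonneg _
    rw [Finset.prod_insert ha, Finset.card_insert_of_notMem ha, Finset.prod_range_succ, mul_comm]
    refine mul_le_mul (ih hT) ?_ (div_nonneg (by positivity) (by linarith))
      (Finset.prod_nonneg fun i _ => by positivity)
    rw [div_le_iff₀ (by linarith), add_mul, div_mul_eq_mul_div, ← sub_le_iff_le_add',
      le_div_iff₀ (by positivity)]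
    linarith

theorem prod_one_add_le_sqrt (j : ℕ) :
    ∏ i ∈ Finset.range j, (1 + 1 / (2 * ((i : ℝ) + 1))) ≤ √(2 * j + 1) := by
  refine Real.le_sqrt_of_sq_le ?_
  induction j with
  | zero => simp
  | succ j ih =>
    rw [Finset.prod_range_succ, mul_pow]
    calc _ ≤ (2 * (j : ℝ) + 1) * (1 + 1 / (2 * ((j : ℝ) + 1))) ^ 2 := by gcongr
      _ ≤ _ := by
        push_cast
        have : (1 + 1 / (2 * ((j : ℝ) + 1))) ^ 2 = (2 * j + 3) ^ 2 / (2 * j + 2) ^ 2 := by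
          field_simp; ring
        rw [this, ← mul_div_assoc, div_le_iff₀ (by positivity)]
        nlinarith [(Nat.cast_nonneg j : (0 : ℝ) ≤ j)]

theorem rpow_neg_le_sub_div {u ε : ℝ} (hu : 3 ≤ u) (hε : 0 < ε) :
    u ^ (-(1 + ε)) ≤ ((u - 2) ^ (-ε) - u ^ (-ε)) / (2 * ε) := by
  have hu0 : 0 < u := by linarith
  rw [le_div_iff₀ (by positivity)]
  have h1 : u ^ (-(1 + ε)) = u ^ (-ε) * u⁻¹ := by
    rw [← Real.rpow_neg_one u, ← Real.rpow_add hu0]; congr 1; ring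
  have h2 : (u - 2) ^ (-ε) = u ^ (-ε) * Real.exp (-ε * Real.log (1 - 2 / u)) := by
    have h3 : 0 < 1 - 2 / u := by rw [sub_pos, div_lt_one hu0]; linarith
    have h4 : u - 2 = u * (1 - 2 / u) := by field_simp
    rw [h4, Real.mul_rpow hu0.le h3.le, Real.rpow_def_of_pos h3, mul_comm (Real.log _)]
  have h3 : 0 < 1 - 2 / u := by rw [sub_pos, div_lt_one hu0]; linarith
  have h5 : Real.log (1 - 2 / u) ≤ - (2 / u) := by linarith [Real.log_le_sub_one_of_pos h3]
  have h6 : 1 + 2 * ε * u⁻¹ ≤ Real.exp (-ε * Real.log (1 - 2 / u)) := by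
    refine le_trans ?_ (Real.add_one_le_exp _)
    have : ε * (2 / u) ≤ ε * (- Real.log (1 - 2 / u)) := by gcongr; linarith
    have h7 : ε * (2 / u) = 2 * ε * u⁻¹ := by ring
    linarith
  rw [h1, h2]
  have h8 : 0 < u ^ (-ε) := Real.rpow_pos_of_pos hu0 _
  nlinarith [mul_le_mul_of_nonneg_left h6 h8.le]

theorem sum_odd_rpow_le_sub (T : Finset ℕ) (hT : ∀ m ∈ T, Odd m ∧ 3 ≤ m) {ε : ℝ} (hε : 0 < ε)
    {M : ℕ} (hM1 : 1 ≤ M) (hM : ∀ m ∈ T, m ≤ M) :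
    ∑ m ∈ T, (m : ℝ) ^ (-(1 + ε)) ≤ (1 - (M : ℝ) ^ (-ε)) / (2 * ε) := by
  induction T using Finset.induction_on_max generalizing M with
  | empty =>
    have : (M : ℝ) ^ (-ε) ≤ 1 :=
      Real.rpow_le_one_of_one_le_of_nonpos (by exact_mod_cast hM1) (by linarith)
    simp only [Finset.sum_empty]
    exact div_nonneg (by linarith) (by positivity)
  | insert a T h ih =>
    have ha : a ∉ T := fun h' => lt_irrefl _ (h a h')
    have hT' : ∀ p ∈ T, Odd p ∧ 3 ≤ p := fun p hp => hT p (Finset.mem_insert_of_mem hp)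
    obtain ⟨⟨k, hk⟩, ha3⟩ := hT a (Finset.mem_insert_self a T)
    have h1 := ih hT' (M := a - 2) (by omega) (fun m hm => by
      obtain ⟨⟨l, hl⟩, -⟩ := hT' m hm
      have := h m hm
      omega)
    rw [Nat.cast_sub (by omega)] at h1
    have h2 := rpow_neg_le_sub_div (u := a) (by exact_mod_cast ha3) hε
    have h3 : (M : ℝ) ^ (-ε) ≤ (a : ℝ) ^ (-ε) := by
      refine Real.rpow_le_rpow_of_nonpos (by positivity) ?_ (by linarith)
      exact_mod_cast hM a (Finset.mem_insert_self a T)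
    rw [Finset.sum_insert ha]
    calc _ ≤ _ := add_le_add h2 h1
      _ = (1 - (a : ℝ) ^ (-ε)) / (2 * ε) := by push_cast; ring
      _ ≤ _ := by gcongr

theorem sum_odd_rpow_le (T : Finset ℕ) (hT : ∀ m ∈ T, Odd m ∧ 3 ≤ m) {ε : ℝ} (hε : 0 < ε) :
    ∑ m ∈ T, (m : ℝ) ^ (-(1 + ε)) ≤ 1 / (2 * ε) := by
  refine (sum_odd_rpow_le_sub T hT hε (M := T.sup id + 1) (by omega) fun m hm => ?_).trans ?_
  · exact (Finset.le_sup (f := id) hm).trans (Nat.le_succ _)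
  · gcongr
    have : (0 : ℝ) ≤ ((T.sup id + 1 : ℕ) : ℝ) ^ (-ε) := by positivity
    linarith

theorem prod_inv_one_sub_rpow_le (S : Finset ℕ) (hS : ∀ p ∈ S, p.Prime ∧ Odd p) {ε : ℝ}
    (hε : 0 < ε) :
    ∏ p ∈ S, (1 - (p : ℝ) ^ (-(1 + ε)))⁻¹ ≤ 1 + 1 / (2 * ε) := by
  let f : ℕ →* ℝ :=
    { toFun := fun n => (n : ℝ) ^ (-(1 + ε))
      map_one' := by simp
      map_mul' := fun m n => by
        rw [Nat.cast_mul, Real.mul_rpow (Nat.cast_nonneg _) (Nat.cast_nonneg _)] }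
  have hf : ∀ {p : ℕ}, p.Prime → ‖f p‖ < 1 := fun {p} hp => by
    change ‖(p : ℝ) ^ (-(1 + ε))‖ < 1
    rw [Real.norm_of_nonneg (by positivity)]
    exact Real.rpow_lt_one_of_one_lt_of_neg (by exact_mod_cast hp.one_lt) (by linarith)
  have h := (EulerProduct.summable_and_hasSum_factoredNumbers_prod_filter_prime_geometric
    hf S).2
  rw [Finset.filter_true_of_mem fun p hp => (hS p hp).1] at h
  refine hasSum_le_of_sum_le h fun U => ?_
  let V : Finset ℕ := U.map (Function.Embedding.subtype _)
  have hV : ∑ i ∈ U, f i = ∑ m ∈ V, f m := by simp [V]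
  have hodd : ∀ m ∈ V, Odd m := by
    intro m hm
    simp only [V, Finset.mem_map, Function.Embedding.subtype_apply] at hm
    obtain ⟨⟨x, hx⟩, -, rfl⟩ := hm
    by_contra hev
    rw [Nat.not_odd_iff_even, even_iff_two_dvd] at hev
    have := hx.2 2 ((Nat.mem_primeFactorsList hx.1).2 ⟨Nat.prime_two, hev⟩)
    exact absurd (hS 2 this).2 (by decide)
  rw [hV, ← Finset.sum_filter_add_sum_filter_not V (fun m => m = 1)]
  refine add_le_add ?_ ?_
  · rw [Finset.filter_eq']
    split_ifs <;> simp
  · refine sum_odd_rpow_le _ (fun m hm => ?_) hε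
    rw [Finset.mem_filter] at hm
    obtain ⟨k, hk⟩ := hodd m hm.1
    exact ⟨⟨k, hk⟩, by omega⟩

theorem prime_pow_div_dvd_factorial {p : ℕ} (hp : p.Prime) (n : ℕ) : p ^ (n / p) ∣ n.factorial := by
  have : Fact p.Prime := ⟨hp⟩
  rw [padicValNat_dvd_iff_le (Nat.factorial_ne_zero n)]
  calc n / p ≤ padicValNat p (p * (n / p)).factorial := by
        rw [padicValNat_factorial_mul]; omega
    _ ≤ _ := padicValNat_dvd_iff_le (Nat.factorial_ne_zero n) |>.1
      (pow_padicValNat_dvd.trans (Nat.factorial_dvd_factorial (Nat.mul_div_le n p)))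

/-- The upper bound in the first theorem of Mertens. -/
theorem sum_log_div_le (S : Finset ℕ) (hS : ∀ p ∈ S, p.Prime) {n : ℕ} (hn : 1 ≤ n)
    (hSn : ∀ p ∈ S, p ≤ n) :
    ∑ p ∈ S, Real.log p / p ≤ Real.log n + Real.log 4 := by
  have hn0 : (0 : ℝ) < n := by exact_mod_cast hn
  have hdvd : ∏ p ∈ S, p ^ (n / p) ∣ n.factorial := by
    refine Finset.prod_dvd_of_isRelPrime (fun p hp q hq hpq => ?_)
      fun p hp => prime_pow_div_dvd_factorial (hS p hp) n
    exact Nat.coprime_iff_isRelPrime.1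
      (Nat.Coprime.pow _ _ ((Nat.coprime_primes (hS p hp) (hS q hq)).2 hpq))
  have hle : ∏ p ∈ S, p ^ (n / p) ≤ n ^ n :=
    (Nat.le_of_dvd (Nat.factorial_pos n) hdvd).trans (Nat.factorial_le_pow n)
  have hlog : ∑ p ∈ S, ((n / p : ℕ) : ℝ) * Real.log p ≤ n * Real.log n := by
    have h := Real.log_le_log (x := ((∏ p ∈ S, p ^ (n / p) : ℕ) : ℝ)) (y := ((n ^ n : ℕ) : ℝ))
      (by exact_mod_cast Finset.prod_pos fun p hp => pow_pos (hS p hp).pos _) (by exact_mod_cast hle)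
    push_cast at h
    rw [Real.log_prod (fun p hp => pow_ne_zero _ (by exact_mod_cast (hS p hp).ne_zero))] at h
    simpa only [Real.log_pow] using h
  have htheta : ∑ p ∈ S, Real.log p ≤ Real.log 4 * n := by
    refine le_trans ?_ (Chebyshev.theta_le_log4_mul_x hn0.le)
    rw [Chebyshev.theta_eq_sum_primesLE_log]
    refine Finset.sum_le_sum_of_subset_of_nonneg (fun p hp => ?_) fun p _ _ => Real.log_natCast_nonneg p
    simpa [Nat.mem_primesLE] using ⟨hSn p hp, hS p hp⟩
  have hterm : ∀ p ∈ S, n * (Real.log p / p) ≤ ((n / p : ℕ) : ℝ) * Real.log p + Real.log p := by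
    intro p hp
    have hp0 : (0 : ℝ) < p := by exact_mod_cast (hS p hp).pos
    have h1 : (n : ℝ) / p ≤ ((n / p : ℕ) : ℝ) + 1 := by
      rw [div_le_iff₀ hp0]
      exact_mod_cast (Nat.lt_mul_of_div_lt (Nat.lt_succ_self _) (hS p hp).pos).le
    have h2 := mul_le_mul_of_nonneg_right h1 (Real.log_natCast_nonneg p)
    calc _ = (n : ℝ) / p * Real.log p := by ring
      _ ≤ _ := h2
      _ = _ := by ring
  have := Finset.sum_le_sum hterm
  rw [← Finset.mul_sum, Finset.sum_add_distrib] at this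
  refine le_of_mul_le_mul_left ?_ hn0
  linarith

theorem div_sub_one_le_inv_mul_exp {p ε : ℝ} (hp : 1 < p) (hε : 0 < ε) :
    p / (p - 1) ≤ (1 - p ^ (-(1 + ε)))⁻¹ * Real.exp (ε * (Real.log p / (p - 1))) := by
  have hp0 : 0 < p := by linarith
  have h0 : 0 < 1 - p ^ (-(1 + ε)) :=
    sub_pos.2 (Real.rpow_lt_one_of_one_lt_of_neg hp (by linarith))
  rw [inv_mul_eq_div, le_div_iff₀ h0]
  have h1 : p * p ^ (-(1 + ε)) = p ^ (-ε) := by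
    nth_rewrite 1 [← Real.rpow_one p]
    rw [← Real.rpow_add hp0]; congr 1; ring
  have h2 : 1 - ε * Real.log p ≤ p ^ (-ε) := by
    rw [Real.rpow_def_of_pos hp0]
    have := Real.add_one_le_exp (Real.log p * -ε)
    linarith
  have hp1 : 0 < p - 1 := by linarith
  calc p / (p - 1) * (1 - p ^ (-(1 + ε))) = (p - p * p ^ (-(1 + ε))) / (p - 1) := by ring
    _ ≤ (p - 1 + ε * Real.log p) / (p - 1) := by rw [h1]; gcongr; linarith
    _ = ε * (Real.log p / (p - 1)) + 1 := by field_simp; ring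
    _ ≤ _ := Real.add_one_le_exp _

/-- For a root `α` of `f`, the quotient `α ^ d / N(α)` is a root of unity in a field of degree `d`;
`k` is its order. -/
theorem exists_totient_le_of_isLeast (f : Polynomial ℚ) (hf : Irreducible f) (hd2 : 2 ≤ f.natDegree) (m : ℕ)
    (hm : IsLeast {k : ℕ | 0 < k ∧ ∃ r : ℚ, f ∣ Polynomial.X ^ k - Polynomial.C r} m) :
    ∃ k : ℕ, 0 < k ∧ k.totient ≤ f.natDegree ∧
      m ≤ f.natDegree * (if Even k then k / 2 else k) := by
  have : Fact (Irreducible f) := ⟨hf⟩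
  set d := f.natDegree with hd
  let K := AdjoinRoot f
  let α : K := AdjoinRoot.root f
  have hfin : Module.finrank ℚ K = d := by
    rw [(AdjoinRoot.powerBasis hf.ne_zero).finrank, AdjoinRoot.powerBasis_dim]
  have : FiniteDimensional ℚ K := (AdjoinRoot.powerBasis hf.ne_zero).finite
  have key : ∀ (k : ℕ) (r : ℚ), f ∣ Polynomial.X ^ k - Polynomial.C r ↔ α ^ k = algebraMap ℚ K r := by
    intro k r
    rw [← AdjoinRoot.mk_eq_zero, map_sub, map_pow, AdjoinRoot.mk_X, AdjoinRoot.mk_C, sub_eq_zero]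
    rfl
  have hα : α ≠ 0 := by
    intro h0
    have h1 : f ∣ Polynomial.X ^ 1 - Polynomial.C 0 := (key 1 0).2 (by simp [h0])
    have := Polynomial.natDegree_le_of_dvd h1 (by simp)
    simp at this
    omega
  obtain ⟨⟨hm0, r, hr⟩, hmin⟩ := hm
  rw [key] at hr
  set N : ℚ := Algebra.norm ℚ α with hN
  have hN0 : N ≠ 0 := Algebra.norm_ne_zero_iff.2 hα
  have hN0' : algebraMap ℚ K N ≠ 0 := by simpa using hN0
  have hNm : N ^ m = r ^ d := by
    rw [hN, ← map_pow, hr, Algebra.norm_algebraMap, hfin]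
  set ζ : K := α ^ d / algebraMap ℚ K N with hζ
  have hζm : ζ ^ m = 1 := by
    rw [hζ, div_pow, ← pow_mul, mul_comm d m, pow_mul, hr, ← map_pow, ← map_pow, hNm,
      div_self]
    rw [← hNm]; simpa using fun h => absurd h hN0
  have hαζ : α ^ d = ζ * algebraMap ℚ K N := by rw [hζ, div_mul_cancel₀ _ hN0']
  have hfo : IsOfFinOrder ζ := isOfFinOrder_iff_pow_eq_one.2 ⟨m, hm0, hζm⟩
  have hk0 : 0 < orderOf ζ := hfo.orderOf_pos
  have hprim : IsPrimitiveRoot ζ (orderOf ζ) := IsPrimitiveRoot.orderOf ζ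
  refine ⟨orderOf ζ, hk0, ?_, ?_⟩
  · rw [← Polynomial.natDegree_cyclotomic (orderOf ζ) ℚ, Polynomial.cyclotomic_eq_minpoly_rat hprim hk0,
      ← hfin]
    exact minpoly.natDegree_le ζ
  · split_ifs with hev
    · have hsq : ζ ^ (orderOf ζ / 2) = -1 := by
        have h2 : IsPrimitiveRoot (ζ ^ (orderOf ζ / 2)) 2 :=
          hprim.pow hk0 (Nat.div_mul_cancel hev.two_dvd).symm
        exact h2.eq_neg_one_of_two_right
      refine hmin ⟨?_, -N ^ (orderOf ζ / 2), ?_⟩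
      · have := hev.two_dvd
        have : 0 < orderOf ζ / 2 := by omega
        positivity
      · rw [key, pow_mul, hαζ, mul_pow, hsq, neg_one_mul, map_neg, map_pow]
    · refine hmin ⟨by positivity, N ^ orderOf ζ, ?_⟩
      rw [key, pow_mul, hαζ, mul_pow, pow_orderOf_eq_one, one_mul, map_pow]

theorem eq_totient_mul_prod_erase_two {k : ℕ} (hk : 0 < k) :
    ((if Even k then k / 2 else k : ℕ) : ℝ) =
      k.totient * ∏ p ∈ k.primeFactors.erase 2, ((p : ℝ) / (p - 1)) ∧
    ∏ p ∈ k.primeFactors.erase 2, (p - 1) ≤ k.totient := by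
  have htot : ((k.totient : ℕ) : ℝ) * ∏ p ∈ k.primeFactors, (p : ℝ) =
      k * ∏ p ∈ k.primeFactors, ((p : ℝ) - 1) := by
    have h := congrArg (Nat.cast (R := ℝ)) (Nat.totient_mul_prod_primeFactors k)
    push_cast at h
    rw [h]
    congr 1
    refine Finset.prod_congr rfl fun p hp => ?_
    rw [Nat.cast_sub (Nat.prime_of_mem_primeFactors hp).one_le, Nat.cast_one]
  constructor
  · have hS : ∀ p ∈ k.primeFactors.erase 2, (p : ℝ) - 1 ≠ 0 := fun p hp => by
      have : (1 : ℝ) < p := by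
        exact_mod_cast (Nat.prime_of_mem_primeFactors (Finset.mem_of_mem_erase hp)).one_lt
      linarith
    rw [Finset.prod_div_distrib, ← mul_div_assoc, eq_div_iff (Finset.prod_ne_zero_iff.2 hS)]
    split_ifs with hev
    · have h2 : 2 ∈ k.primeFactors :=
        Nat.mem_primeFactors.2 ⟨Nat.prime_two, hev.two_dvd, hk.ne'⟩
      rw [← Finset.mul_prod_erase _ _ h2, ← Finset.mul_prod_erase _ _ h2] at htot
      rw [Nat.cast_div hev.two_dvd (by norm_num)]
      push_cast at htot ⊢
      linarith
    · have h2 : 2 ∉ k.primeFactors := fun h => hev (even_iff_two_dvd.2 (Nat.dvd_of_mem_primeFactors h))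
      rw [Finset.erase_eq_of_notMem h2]
      exact htot.symm
  · have h1 : ∏ p ∈ k.primeFactors, (p - 1) ≤ k.totient := by
      have h := Nat.totient_mul_prod_primeFactors k
      have hle := Nat.le_of_dvd hk (Nat.prod_primeFactors_dvd k)
      have hpos : 0 < ∏ p ∈ k.primeFactors, p := Finset.prod_pos fun p hp => Nat.pos_of_mem_primeFactors hp
      refine Nat.le_of_mul_le_mul_left ?_ hk
      rw [← h, mul_comm k]
      exact Nat.mul_le_mul_left _ hle
    refine le_trans (Finset.prod_le_prod_of_subset_of_one_le' (Finset.erase_subset _ _) fun p hp _ => ?_) h1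
    have := (Nat.prime_of_mem_primeFactors hp).two_le
    omega

theorem sum_log_div_mul_sub_one_le (S : Finset ℕ) (hS : ∀ p ∈ S, Odd p ∧ 3 ≤ p) :
    ∑ p ∈ S, Real.log p / (p * (p - 1)) ≤ 3 / 2 := by
  calc _ ≤ ∑ p ∈ S, 3 / 2 * (p : ℝ) ^ (-(1 + 1 / 2 : ℝ)) := by
        refine Finset.sum_le_sum fun p hp => ?_
        have hp3 : (3 : ℝ) ≤ p := by exact_mod_cast (hS p hp).2
        have hp0 : (0 : ℝ) < p := by linarith
        have h1 : Real.log p ≤ (p : ℝ) ^ (1 / 2 : ℝ) := by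
          have h2 := Real.log_le_sub_one_of_pos (x := (p : ℝ) ^ (1 / 4 : ℝ)) (by positivity)
          rw [Real.log_rpow hp0] at h2
          have h3 : (p : ℝ) ^ (1 / 2 : ℝ) = ((p : ℝ) ^ (1 / 4 : ℝ)) ^ 2 := by
            rw [← Real.rpow_natCast, ← Real.rpow_mul hp0.le]; norm_num
          rw [h3]
          nlinarith [sq_nonneg ((p : ℝ) ^ (1 / 4 : ℝ) - 2)]
        have h4 : (p : ℝ) ^ (-(1 + 1 / 2 : ℝ)) = (p : ℝ) ^ (1 / 2 : ℝ) / p ^ 2 := by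
          rw [← Real.rpow_natCast, ← Real.rpow_sub hp0]; norm_num
        rw [h4, ← mul_div_assoc, div_le_div_iff₀ (by nlinarith) (by positivity)]
        calc Real.log p * (p : ℝ) ^ 2 ≤ (p : ℝ) ^ (1 / 2 : ℝ) * (p : ℝ) ^ 2 := by gcongr
          _ ≤ (p : ℝ) ^ (1 / 2 : ℝ) * (3 / 2 * (p * (p - 1))) := by
              gcongr; nlinarith
          _ = _ := by ring
    _ = 3 / 2 * ∑ p ∈ S, (p : ℝ) ^ (-(1 + 1 / 2 : ℝ)) := by rw [Finset.mul_sum]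
    _ ≤ 3 / 2 * (1 / (2 * (1 / 2))) := by
        gcongr; exact sum_odd_rpow_le S hS (by norm_num)
    _ = _ := by norm_num

theorem sum_log_div_sub_one_le (S : Finset ℕ) (hS : ∀ p ∈ S, p.Prime ∧ Odd p) {y : ℝ}
    (hy : 512 ≤ y) (hSy : ∑ p ∈ S, Real.log ((p : ℝ) - 1) ≤ y) :
    ∑ p ∈ S, Real.log p / (p - 1) ≤ Real.log y + 4.9 := by
  have hS3 : ∀ p ∈ S, Odd p ∧ 3 ≤ p := fun p hp => by
    obtain ⟨h1, k, hk⟩ := hS p hp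
    exact ⟨⟨k, hk⟩, by have := h1.two_le; omega⟩
  have hy0 : 0 < y := by linarith
  set n := ⌈y⌉₊ with hn
  have hyn : y ≤ n := Nat.le_ceil y
  have hny : (n : ℝ) < y + 1 := Nat.ceil_lt_add_one hy0.le
  have hn0 : (0 : ℝ) < n := by linarith
  have hlogn : Real.log n ≤ Real.log y + 1 / 512 := by
    have h1 : Real.log n ≤ Real.log (y * (1 + 1 / 512)) :=
      Real.log_le_log hn0 (by linarith)
    rw [Real.log_mul hy0.ne' (by norm_num)] at h1
    linarith [Real.log_le_sub_one_of_pos (x := 1 + 1 / 512) (by norm_num)]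
  have hlog4 : Real.log 4 ≤ 1.387 := by
    rw [show (4 : ℝ) = 2 ^ 2 by norm_num, Real.log_pow]
    have := Real.log_two_lt_d9
    push_cast; linarith
  have hsmall := sum_log_div_le (S.filter (· ≤ n)) (fun p hp => (hS p (Finset.mem_filter.1 hp).1).1)
    (n := n) (by exact_mod_cast hn0) fun p hp => (Finset.mem_filter.1 hp).2
  have hlarge : ∑ p ∈ S.filter (¬ · ≤ n), Real.log p / p ≤ 2 := by
    calc _ ≤ ∑ p ∈ S.filter (¬ · ≤ n), 2 / n * Real.log ((p : ℝ) - 1) := by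
          refine Finset.sum_le_sum fun p hp => ?_
          rw [Finset.mem_filter, not_le] at hp
          have hp3 : (3 : ℝ) ≤ p := by exact_mod_cast (hS3 p hp.1).2
          have hpn : (n : ℝ) ≤ p := by exact_mod_cast hp.2.le
          have h1 : Real.log p ≤ 2 * Real.log ((p : ℝ) - 1) := by
            have h2 : Real.log p ≤ Real.log (((p : ℝ) - 1) ^ 2) :=
              Real.log_le_log (by linarith) (by nlinarith)
            rwa [Real.log_pow] at h2
          calc Real.log p / p ≤ Real.log p / n := by
                gcongr
            _ ≤ 2 * Real.log ((p : ℝ) - 1) / n := by gcongr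
            _ = _ := by ring
      _ ≤ ∑ p ∈ S, 2 / n * Real.log ((p : ℝ) - 1) := by
          refine Finset.sum_le_sum_of_subset_of_nonneg (Finset.filter_subset _ _) fun p hp _ => ?_
          have hp3 : (3 : ℝ) ≤ p := by exact_mod_cast (hS3 p hp).2
          exact mul_nonneg (by positivity) (Real.log_nonneg (by linarith))
      _ ≤ 2 / n * y := by rw [← Finset.mul_sum]; gcongr
      _ ≤ 2 := by rw [div_mul_eq_mul_div, div_le_iff₀ hn0]; linarith
  have hsplit : ∑ p ∈ S, Real.log p / ((p : ℝ) - 1) =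
      ∑ p ∈ S, Real.log p / (p * ((p : ℝ) - 1)) + ∑ p ∈ S, Real.log p / p := by
    rw [← Finset.sum_add_distrib]
    refine Finset.sum_congr rfl fun p hp => ?_
    have hp3 : (3 : ℝ) ≤ p := by exact_mod_cast (hS3 p hp).2
    have h1 : (p : ℝ) - 1 ≠ 0 := by linarith
    have h2 : (p : ℝ) ≠ 0 := by linarith
    field_simp; ring
  have := sum_log_div_mul_sub_one_le S hS3
  rw [hsplit, ← Finset.sum_filter_add_sum_filter_not S (· ≤ n) (fun p : ℕ => Real.log p / (p : ℝ))]
  linarith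

/-- The factors `(1 - 1/p)⁻¹` are compared with those of the Euler product at `1 + ε`, where
`1/ε` is the bound of `sum_log_div_sub_one_le`. -/
theorem prod_div_sub_one_le_of_large (S : Finset ℕ) (hS : ∀ p ∈ S, p.Prime ∧ Odd p) {y : ℝ}
    (hy : 512 ≤ y) (hSy : ∑ p ∈ S, Real.log ((p : ℝ) - 1) ≤ y) :
    ∏ p ∈ S, ((p : ℝ) / (p - 1)) ≤ 3 * Real.log y := by
  have hl : 6.2 ≤ Real.log y := by
    have h1 := Real.log_le_log (by norm_num) hy
    rw [show (512 : ℝ) = 2 ^ 9 by norm_num, Real.log_pow] at h1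
    have := Real.log_two_gt_d9
    push_cast at h1; linarith
  set B := Real.log y + 4.9 with hB
  have hB0 : 0 < B := by linarith
  have hε : 0 < 1 / B := by positivity
  calc _ ≤ ∏ p ∈ S, ((1 - (p : ℝ) ^ (-(1 + 1 / B)))⁻¹ *
          Real.exp (1 / B * (Real.log p / (p - 1)))) := by
        refine Finset.prod_le_prod (fun p hp => ?_) fun p hp => ?_
        all_goals have hp1 : (1 : ℝ) < p := by exact_mod_cast (hS p hp).1.one_lt
        · exact div_nonneg (by linarith) (by linarith)
        · exact div_sub_one_le_inv_mul_exp hp1 hε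
    _ = (∏ p ∈ S, (1 - (p : ℝ) ^ (-(1 + 1 / B)))⁻¹) *
          Real.exp (1 / B * ∑ p ∈ S, Real.log p / (p - 1)) := by
        rw [Finset.prod_mul_distrib, Finset.mul_sum, Real.exp_sum]
    _ ≤ (1 + 1 / (2 * (1 / B))) * Real.exp (1 / B * B) := by
        gcongr
        · exact prod_inv_one_sub_rpow_le S hS hε
        · exact sum_log_div_sub_one_le S hS hy hSy
    _ = (1 + B / 2) * Real.exp 1 := by
        rw [one_div_mul_cancel hB0.ne']; congr 2; field_simp
    _ ≤ (1 + B / 2) * 2.7183 := by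
        gcongr; linarith [Real.exp_one_lt_d9]
    _ ≤ _ := by linarith

theorem prod_div_sub_one_le_of_card (S : Finset ℕ) (hS : ∀ p ∈ S, Odd p ∧ 3 ≤ p) {j : ℕ}
    (hj : S.card ≤ j) :
    ∏ p ∈ S, ((p : ℝ) / (p - 1)) ≤ ∏ i ∈ Finset.range j, (1 + 1 / (2 * ((i : ℝ) + 1))) := by
  refine (prod_div_sub_one_le S hS).trans ?_
  refine Finset.prod_le_prod_of_subset_of_one_le (Finset.range_subset_range.2 hj) (fun i _ => by positivity)
    fun i _ _ => ?_
  have : (0 : ℝ) ≤ 1 / (2 * ((i : ℝ) + 1)) := by positivity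
  linarith

theorem log_ge_of_two_pow_le {x : ℝ} {b : ℕ} (h : (2 : ℝ) ^ b ≤ x) : b * 0.6931 ≤ Real.log x := by
  have h1 := Real.log_le_log (by positivity) h
  rw [Real.log_pow] at h1
  refine le_trans ?_ h1
  gcongr
  linarith [Real.log_two_gt_d9]

theorem le_log_log {x : ℝ} {a b : ℕ} (ha : (2 : ℝ) ^ b ≤ x) (hab : (2 : ℝ) ^ a ≤ b * 0.6931) :
    a * 0.6931 ≤ Real.log (Real.log x) :=
  log_ge_of_two_pow_le (hab.trans (log_ge_of_two_pow_le ha))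

theorem two_pow_le_of_card (S : Finset ℕ) (hS : ∀ p ∈ S, Odd p ∧ 3 ≤ p) {d i b : ℕ}
    (hd : ∏ p ∈ S, (p - 1) ≤ d) (hi : i ≤ S.card) (hib : 2 ^ b ≤ 2 ^ i * i.factorial) :
    (2 : ℝ) ^ b ≤ d := by
  have h : 2 ^ i * i.factorial ≤ 2 ^ S.card * S.card.factorial :=
    Nat.mul_le_mul (Nat.pow_le_pow_right (by norm_num) hi) (Nat.factorial_le hi)
  exact_mod_cast hib.trans (h.trans ((two_pow_mul_factorial_le_prod S hS).trans hd))

theorem div_le_log {x : ℝ} (hx : 0 < x) (p q : ℕ) (hq : 0 < q) (h : (2.7183 : ℝ) ^ p ≤ x ^ q) :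
    (p / q : ℝ) ≤ Real.log x := by
  have hq' : (0 : ℝ) < q := by exact_mod_cast hq
  rw [div_le_iff₀' hq', ← Real.log_pow, Real.le_log_iff_exp_le (by positivity)]
  refine le_trans ?_ h
  rw [← Real.exp_one_pow]
  gcongr
  linarith [Real.exp_one_lt_d9]

theorem three_halves_mul_le {d : ℕ} (hd : 2 ≤ d) :
    (d : ℝ) * (3 / 2) ≤ 3 * d * Real.log (Real.log d) + 7 := by
  have h2 := Real.log_two_gt_d9
  rcases le_or_gt 6 d with h6 | h6
  · have h6' : (6 : ℝ) ≤ d := by exact_mod_cast h6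
    have h1 : 1.7 ≤ Real.log d := by
      have h3 := Real.log_le_log (x := (2 : ℝ) ^ 5) (y := (d : ℝ) ^ 2) (by norm_num) (by nlinarith)
      rw [Real.log_pow, Real.log_pow] at h3
      push_cast at h3; linarith
    have h3 := div_le_log (x := Real.log d) (by linarith) 1 2 (by norm_num) (by nlinarith)
    push_cast at h3
    nlinarith
  · interval_cases d
    · have h3 := Real.one_sub_inv_le_log_of_pos (x := Real.log 2) (by linarith)
      have h4 : (Real.log 2)⁻¹ ≤ (0.69)⁻¹ := by gcongr; linarith
      norm_num at h4 ⊢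
      linarith
    · have h3 : 0 ≤ Real.log (Real.log 3) := Real.log_nonneg <| by
        rw [Real.le_log_iff_exp_le (by norm_num)]; linarith [Real.exp_one_lt_d9]
      push_cast; linarith
    · have h3 : 0 ≤ Real.log (Real.log 4) := Real.log_nonneg <| by
        rw [Real.le_log_iff_exp_le (by norm_num)]; linarith [Real.exp_one_lt_d9]
      push_cast; linarith
    · have h1 : 1.38 ≤ Real.log 5 := by
        have h3 := Real.log_le_log (x := (2 : ℝ) ^ 2) (y := 5) (by norm_num) (by norm_num)
        rw [Real.log_pow] at h3
        push_cast at h3; linarith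
      have h4 : (1.38 : ℝ) ^ 4 ≤ (Real.log 5) ^ 4 := by gcongr
      have h3 := div_le_log (x := Real.log 5) (by linarith) 1 4 (by norm_num)
        (le_trans (by norm_num) h4)
      push_cast at h3 ⊢
      linarith

theorem prod_div_sub_one_le_of_card_range (S : Finset ℕ) (hS : ∀ p ∈ S, Odd p ∧ 3 ≤ p)
    {d i j : ℕ} (a b : ℕ) (hd : ∏ p ∈ S, (p - 1) ≤ d) (hi : i ≤ S.card) (hj : S.card ≤ j)
    (hib : 2 ^ b ≤ 2 ^ i * i.factorial) (hab : (2 : ℝ) ^ a ≤ b * 0.6931)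
    (haj : (2 * j + 1 : ℝ) ≤ (3 * (a * 0.6931)) ^ 2) :
    ∏ p ∈ S, ((p : ℝ) / (p - 1)) ≤ 3 * Real.log (Real.log d) := by
  have h1 := le_log_log (two_pow_le_of_card S hS hd hi hib) hab
  have h2 := (prod_div_sub_one_le_of_card S hS hj).trans (prod_one_add_le_sqrt j)
  have h3 : √(2 * j + 1) ≤ 3 * (a * 0.6931) := by
    rw [Real.sqrt_le_left (by positivity)]; exact haj
  linarith

set_option exponentiation.threshold 1000 in
theorem mul_prod_div_sub_one_le (S : Finset ℕ) (hS : ∀ p ∈ S, p.Prime ∧ Odd p) {d : ℕ}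
    (hd2 : 2 ≤ d) (hd : ∏ p ∈ S, (p - 1) ≤ d) :
    d * ∏ p ∈ S, ((p : ℝ) / (p - 1)) ≤ 3 * d * Real.log (Real.log d) + 7 := by
  have hS3 : ∀ p ∈ S, Odd p ∧ 3 ≤ p := fun p hp => by
    obtain ⟨h1, k, hk⟩ := hS p hp
    exact ⟨⟨k, hk⟩, by have := h1.two_le; omega⟩
  have hd0 : (0 : ℝ) < d := by positivity
  rcases le_or_gt S.card 1 with h1 | h1
  · have h2 := prod_div_sub_one_le_of_card S hS3 h1
    norm_num [-Finset.prod_div_distrib] at h2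
    exact (mul_le_mul_of_nonneg_left h2 hd0.le).trans (three_halves_mul_le hd2)
  suffices h : ∏ p ∈ S, ((p : ℝ) / (p - 1)) ≤ 3 * Real.log (Real.log d) by
    nlinarith [mul_le_mul_of_nonneg_left h hd0.le]
  rcases le_or_gt S.card 2 with h2 | h2
  · have h3 := log_ge_of_two_pow_le (two_pow_le_of_card S hS3 hd (b := 3) h1 (by decide))
    have h4 := prod_div_sub_one_le_of_card S hS3 h2
    norm_num [Finset.prod_range_succ, -Finset.prod_div_distrib] at h3 h4
    have h5 := div_le_log (x := Real.log d) (by linarith) 5 8 (by norm_num)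
      (le_trans (by norm_num) (pow_le_pow_left₀ (by norm_num) h3 8))
    push_cast at h5; linarith
  rcases le_or_gt S.card 3 with h3 | h3
  · have h3' := log_ge_of_two_pow_le (two_pow_le_of_card S hS3 hd (b := 5) h2 (by decide))
    have h4 := prod_div_sub_one_le_of_card S hS3 h3
    norm_num [Finset.prod_range_succ, -Finset.prod_div_distrib] at h3' h4
    have h5 := div_le_log (x := Real.log d) (by linarith) 3 4 (by norm_num)
      (le_trans (by norm_num) (pow_le_pow_left₀ (by norm_num) h3' 4))
    push_cast at h5; linarith
  rcases le_total S.card 7 with h | h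
  · exact prod_div_sub_one_le_of_card_range S hS3 2 8 hd h3 h (by decide) (by norm_num) (by norm_num)
  rcases le_total S.card 18 with h' | h'
  · exact prod_div_sub_one_le_of_card_range S hS3 3 16 hd h h' (by norm_num [Nat.factorial]) (by norm_num) (by norm_num)
  rcases le_total S.card 53 with h | h
  · exact prod_div_sub_one_le_of_card_range S hS3 5 50 hd h' h (by norm_num [Nat.factorial]) (by norm_num) (by norm_num)
  rcases le_total S.card 105 with h' | h'
  · exact prod_div_sub_one_le_of_card_range S hS3 7 200 hd h h' (by norm_num [Nat.factorial]) (by norm_num) (by norm_num)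
  rcases le_total S.card 137 with h | h
  · exact prod_div_sub_one_le_of_card_range S hS3 8 400 hd h' h (by norm_num [Nat.factorial]) (by norm_num) (by norm_num)
  have h1 : (2 : ℝ) ^ 800 ≤ d := two_pow_le_of_card S hS3 hd h (by norm_num [Nat.factorial])
  refine prod_div_sub_one_le_of_large S hS ?_ ?_
  · have h4 := Real.log_le_log (by positivity) h1
    rw [Real.log_pow] at h4
    have := Real.log_two_gt_d9
    push_cast at h4; linarith
  · have h4 := Real.log_le_log (x := ((∏ p ∈ S, (p - 1) : ℕ) : ℝ)) (y := d)
      (by exact_mod_cast Finset.prod_pos fun p hp => Nat.sub_pos_of_lt (hS p hp).1.one_lt)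
      (by exact_mod_cast hd)
    rw [Nat.cast_prod, Real.log_prod] at h4
    · refine le_trans (le_of_eq (Finset.sum_congr rfl fun p hp => ?_)) h4
      rw [Nat.cast_sub (hS p hp).1.one_le, Nat.cast_one]
    · intro p hp
      have := (hS p hp).1.one_lt
      exact_mod_cast (Nat.sub_pos_of_lt this).ne'

open Polynomial in
theorem binomial_multiple_degree_bound (f : Polynomial ℚ) (hf : Irreducible f)
    (d : ℕ) (hd : f.natDegree = d) (hd2 : 2 ≤ d) (m : ℕ)
    (hm : IsLeast {k : ℕ | 0 < k ∧ ∃ r : ℚ, f ∣ X ^ k - C r} m) :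
    (m : ℝ) ≤ (d : ℝ) * (↑⌈3 * (d : ℝ) * Real.log (Real.log d)⌉ + 7) := by
  subst hd
  obtain ⟨k, hk, hkd, hmk⟩ := exists_totient_le_of_isLeast f hf hd2 m hm
  obtain ⟨h1, h2⟩ := eq_totient_mul_prod_erase_two hk
  have hS : ∀ p ∈ k.primeFactors.erase 2, p.Prime ∧ Odd p := fun p hp => by
    have hp' := Nat.prime_of_mem_primeFactors (Finset.mem_of_mem_erase hp)
    exact ⟨hp', hp'.odd_of_ne_two (Finset.ne_of_mem_erase hp)⟩
  have h3 := mul_prod_div_sub_one_le _ hS hd2 (h2.trans hkd)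
  have hmk' : (m : ℝ) ≤ f.natDegree * (if Even k then k / 2 else k : ℕ) := by exact_mod_cast hmk
  refine hmk'.trans ?_
  gcongr
  rw [h1]
  refine le_trans ?_ (h3.trans (add_le_add_left (Int.le_ceil _) 7))
  gcongr
  refine Finset.prod_nonneg fun p hp => ?_
  have : (1 : ℝ) < p := by exact_mod_cast (hS p hp).1.one_lt
  exact div_nonneg (by linarith) (by linarith)
end

section
/- Let f = f₁·f₂⋯f_u ∈ ℚ[x] where f₁,…,f_u are distinct irreducible polynomials, none of which is a scalar multiple of x. For each i let m_i be the least positive integer such that f_i divides x^{m_i} − s for some s ∈ ℚ. If f divides x^m − r for some positive integer m and some r ∈ ℚ, then lcm(m₁,…,m_u) divides m. -/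
open Polynomial in
/-- The least degree of a binomial multiple of an irreducible polynomial not dividing `X`
divides the degree of every binomial multiple. -/
theorem dvd_of_isLeast_binomial_multiple_degree {K : Type*} [Field K] {p : K[X]}
    (hp : Irreducible p) (hpX : ¬ p ∣ X) {k : ℕ}
    (hk : IsLeast {k : ℕ | 0 < k ∧ ∃ s : K, p ∣ X ^ k - C s} k)
    {n : ℕ} {r : K} (hn : p ∣ X ^ n - C r) : k ∣ n := by
  obtain ⟨⟨hk0, s, hs⟩, hmin⟩ := hk
  have hs0 : s ≠ 0 := by
    rintro rfl
    rw [C_0, sub_zero] at hs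
    exact hpX (hp.prime.dvd_of_dvd_pow hs)
  by_contra hkn
  have hpos : 0 < n % k := Nat.pos_of_ne_zero fun h => hkn (Nat.dvd_of_mod_eq_zero h)
  refine (Nat.mod_lt n hk0).not_ge (hmin ⟨hpos, r / s ^ (n / k), ?_⟩)
  have hq : p ∣ (X ^ k) ^ (n / k) - C s ^ (n / k) := hs.trans (sub_dvd_pow_sub_pow _ _ _)
  have hX : (X : K[X]) ^ n = (X ^ k) ^ (n / k) * X ^ (n % k) := by
    rw [← pow_mul, ← pow_add, Nat.div_add_mod]
  have hr : C r = C s ^ (n / k) * C (r / s ^ (n / k)) := by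
    rw [← C_pow, ← C_mul, mul_div_cancel₀ _ (pow_ne_zero _ hs0)]
  have hmul : p ∣ C s ^ (n / k) * (X ^ (n % k) - C (r / s ^ (n / k))) := by
    have h := dvd_sub hn (hq.mul_right (X ^ (n % k)))
    rw [hX, hr] at h
    convert h using 1
    ring
  have hunit : IsUnit (C s ^ (n / k)) := (isUnit_C.mpr hs0.isUnit).pow _
  exact hunit.dvd_mul_left.mp hmul

open Polynomial in
theorem lcm_divides_binomial_multiple_degree (u : ℕ) (hu : 0 < u)
    (fs : Fin u → Polynomial ℚ)
    (hirr : ∀ i, Irreducible (fs i)) (hdist : Function.Injective fs)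
    (hx : ∀ (i : Fin u) (c : ℚ), fs i ≠ C c * X)
    (m : Fin u → ℕ)
    (hm : ∀ i, IsLeast {k : ℕ | 0 < k ∧ ∃ s : ℚ, fs i ∣ X ^ k - C s} (m i))
    (M : ℕ) (hM : 0 < M) (r : ℚ)
    (hdvd : (∏ i, fs i) ∣ X ^ M - C r) :
    Finset.univ.lcm m ∣ M := by
  refine Finset.lcm_dvd fun i _ => ?_
  refine dvd_of_isLeast_binomial_multiple_degree (hirr i) (fun h => ?_) (hm i)
    ((Finset.dvd_prod_of_mem fs (Finset.mem_univ i)).trans hdvd)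
  obtain ⟨v, hv⟩ := ((hirr i).associated_of_dvd irreducible_X h).symm
  obtain ⟨c, -, hc⟩ := isUnit_iff.mp v.isUnit
  exact hx i c (by rw [hc, ← hv, mul_comm])
end

section
/- For every integer d ≥ 841 there exists a nonzero polynomial f ∈ ℤ[x] with deg f ≤ d·ln d and with every coefficient of absolute value at most exp(2d·ln d), such that f has a binomial multiple, and every binomial multiple x^m − a of f (m a positive integer, a ∈ ℚ) satisfies m > exp(√d) and, writing a = p/s in lowest terms with s > 0, max(|p|, s) > 2^{exp(√d)}. -/
open Polynomial in
/-- The product of the first `N` cyclotomic polynomials. -/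
noncomputable def cyclotomicProd (N : ℕ) : Polynomial ℤ :=
  ∏ n ∈ Finset.Icc 1 N, cyclotomic n ℤ

namespace cyclotomicProd

open Polynomial

lemma monic (N : ℕ) : (cyclotomicProd N).Monic :=
  monic_prod_of_monic _ _ fun n _ => cyclotomic.monic n ℤ

lemma natDegree_le (k : ℕ) : (cyclotomicProd (2 * k)).natDegree ≤ 2 * k ^ 2 := by
  rw [cyclotomicProd, natDegree_prod_of_monic _ _ fun n _ => cyclotomic.monic n ℤ]
  simp only [natDegree_cyclotomic]
  induction k with
  | zero => simp
  | succ k ih =>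
    rw [show 2 * (k + 1) = 2 * k + 1 + 1 by ring, Finset.sum_Icc_succ_top (by lia),
      Finset.sum_Icc_succ_top (by lia)]
    have h₁ := Nat.totient_le (2 * k + 1)
    have h₂ := Nat.totient_lt (2 * k + 1 + 1) (by lia)
    nlinarith

lemma dvd_X_pow_factorial_sub_one (N : ℕ) : cyclotomicProd N ∣ X ^ N.factorial - 1 := by
  rw [← prod_cyclotomic_eq_X_pow_sub_one N.factorial_pos]
  refine Finset.prod_dvd_prod_of_subset _ _ _ fun n hn => ?_
  rw [Finset.mem_Icc] at hn
  exact Nat.mem_divisors.2 ⟨Nat.dvd_factorial hn.1 hn.2, N.factorial_ne_zero⟩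

lemma aeval_eq_zero {N n : ℕ} (h₁ : 1 ≤ n) (h₂ : n ≤ N) {ζ : ℂ} (hζ : IsPrimitiveRoot ζ n) :
    aeval ζ (cyclotomicProd N) = 0 := by
  have h := hζ.isRoot_cyclotomic h₁
  rw [IsRoot, ← map_cyclotomic_int, eval_map, ← algebraMap_int_eq, ← aeval_def] at h
  rw [cyclotomicProd, map_prod]
  exact Finset.prod_eq_zero (Finset.mem_Icc.2 ⟨h₁, h₂⟩) h

lemma abs_coeff_le (N i : ℕ) :
    |((cyclotomicProd N).coeff i : ℝ)| ≤ 2 ^ (cyclotomicProd N).natDegree := by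
  set g := cyclotomicProd N with hg
  have hdeg : (g.map (Int.castRingHom ℂ)).natDegree = g.natDegree := (monic N).natDegree_map _
  have h := coeff_le_of_roots_le (p := g.map (Int.castRingHom ℂ)) (f := RingHom.id ℂ) (B := 1) i
    ((monic N).map _) (IsAlgClosed.splits _) ?_
  · rw [hdeg, Polynomial.map_id, coeff_map, one_pow, one_mul, eq_intCast, Complex.norm_intCast] at h
    exact h.trans (by exact_mod_cast Nat.choose_le_two_pow _ _)
  · intro z hz
    rw [Polynomial.map_id] at hz
    have hr := (mem_roots'.1 hz).2
    have hd := Polynomial.map_dvd (Int.castRingHom ℂ) (dvd_X_pow_factorial_sub_one N)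
    have hz₁ := hr.dvd hd
    simp only [Polynomial.map_sub, Polynomial.map_pow, map_X, Polynomial.map_one, IsRoot,
      eval_sub, eval_pow, eval_X, eval_one, sub_eq_zero] at hz₁
    exact (Complex.norm_eq_one_of_pow_eq_one hz₁ N.factorial_ne_zero).le

end cyclotomicProd

/-- The central binomial coefficient of `k` divides every common multiple of `1, …, 2 * k`. -/
lemma centralBinom_dvd_of_forall_dvd {k m : ℕ} (hk : 0 < k)
    (h : ∀ n, 1 ≤ n → n ≤ 2 * k → n ∣ m) : k.centralBinom ∣ m := by
  rw [Nat.dvd_iff_prime_pow_dvd_dvd]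
  intro p j hp hj
  refine h _ (Nat.one_le_pow _ _ hp.pos) ?_
  rw [hp.pow_dvd_iff_le_factorization (Nat.centralBinom_ne_zero k)] at hj
  exact (Nat.pow_le_pow_right hp.pos hj).trans (Nat.pow_factorization_choose_le (by lia))

lemma two_mul_mul_exp_lt_four_pow {k : ℕ} (hk : 29 ≤ k) : 2 * k * Real.exp k < 4 ^ k := by
  induction k, hk using Nat.le_induction with
  | base =>
    have h : Real.exp ((29 : ℕ) : ℝ) < 2.7182818286 ^ 29 := by
      rw [← Real.exp_one_pow]
      exact pow_lt_pow_left₀ Real.exp_one_lt_d9 (Real.exp_pos _).le (by norm_num)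
    norm_num at h ⊢
    linarith
  | succ k hk ih =>
    have he := Real.exp_one_lt_d9
    have hk' : (29 : ℝ) ≤ k := by exact_mod_cast hk
    have h₁ : 2 * ((k : ℝ) + 1) * Real.exp 1 ≤ 2 * k * 4 := by nlinarith
    have h₂ := mul_le_mul_of_nonneg_right h₁ (Real.exp_pos k).le
    push_cast
    rw [Real.exp_add, pow_succ]
    linarith

lemma exp_lt_centralBinom {k : ℕ} (hk : 29 ≤ k) : Real.exp k < k.centralBinom := by
  have h₁ := two_mul_mul_exp_lt_four_pow hk
  have h₂ : (4 : ℝ) ^ k ≤ 2 * k * k.centralBinom := by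
    exact_mod_cast Nat.four_pow_le_two_mul_self_mul_centralBinom k (by lia)
  exact lt_of_mul_lt_mul_left (h₁.trans_le h₂) (by positivity)

open Polynomial in
lemma scaleRoots_cyclotomicProd_dvd (N : ℕ) :
    ((cyclotomicProd N).scaleRoots 2).map (Int.castRingHom ℚ) ∣
      X ^ N.factorial - C (2 ^ N.factorial) := by
  have h := Polynomial.map_dvd (Int.castRingHom ℚ)
    (scaleRoots_dvd (r := 2) _ _ (cyclotomicProd.dvd_X_pow_factorial_sub_one N))
  have hs : (X ^ N.factorial - 1 : ℤ[X]).scaleRoots 2 =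
      X ^ N.factorial - C (2 ^ N.factorial) := by
    ext i
    have hdeg : (X ^ N.factorial - 1 : ℤ[X]).natDegree = N.factorial := by
      simpa using natDegree_X_pow_sub_C (n := N.factorial) (r := (1 : ℤ))
    rw [coeff_scaleRoots, hdeg]
    simp only [coeff_sub, coeff_X_pow, coeff_one, coeff_C]
    have := N.factorial_ne_zero
    split_ifs <;> simp_all
  rw [hs] at h
  simpa [map_ofNat C 2] using h

open Polynomial in
/-- A binomial multiple of the polynomial with roots `2 * ζ`, for `ζ` a root of unity of order at
most `N`, has degree divisible by `1, …, N`. -/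
lemma eq_two_pow_and_dvd_of_scaleRoots_dvd {N m : ℕ} {a : ℚ} (hN : 1 ≤ N)
    (h : ((cyclotomicProd N).scaleRoots 2).map (Int.castRingHom ℚ) ∣ X ^ m - C a) :
    a = 2 ^ m ∧ ∀ n, 1 ≤ n → n ≤ N → n ∣ m := by
  have key : ∀ n, 1 ≤ n → n ≤ N → ∀ ζ : ℂ, IsPrimitiveRoot ζ n → (2 * ζ) ^ m = a := by
    intro n h₁ h₂ ζ hζ
    have hroot := scaleRoots_aeval_eq_zero (r := 2) (cyclotomicProd.aeval_eq_zero h₁ h₂ hζ)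
    obtain ⟨q, hq⟩ := h
    have := congrArg (aeval (2 * ζ)) hq
    rw [map_mul, ← algebraMap_int_eq, aeval_map_algebraMap] at this
    simp only [map_ofNat] at hroot
    rw [hroot, zero_mul] at this
    simpa [sub_eq_zero] using this
  have ha : (2 : ℂ) ^ m = a := by
    simpa using key 1 le_rfl hN 1 IsPrimitiveRoot.one
  refine ⟨by exact_mod_cast ha.symm, fun n h₁ h₂ => ?_⟩
  have hζ := Complex.isPrimitiveRoot_exp n (by lia)
  have h := key n h₁ h₂ _ hζ
  rw [mul_pow, ← ha] at h
  exact hζ.dvd_of_pow_eq_one _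
    (mul_left_cancel₀ (pow_ne_zero m two_ne_zero) (h.trans (mul_one _).symm))

lemma two_mul_sq_le_mul_log {d : ℕ} (hd : 841 ≤ d) :
    2 * ((Nat.sqrt d : ℝ) + 1) ^ 2 ≤ d * Real.log d := by
  have hd' : (841 : ℝ) ≤ d := by exact_mod_cast hd
  have hs : (29 : ℝ) ≤ Nat.sqrt d := by
    exact_mod_cast Nat.le_sqrt.2 (by lia)
  have hs' : (Nat.sqrt d : ℝ) ^ 2 ≤ d := by exact_mod_cast Nat.sqrt_le' d
  have hlog : 6 ≤ Real.log d := by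
    rw [Real.le_log_iff_exp_le (by linarith)]
    have h : Real.exp ((6 : ℕ) : ℝ) < 2.7182818286 ^ 6 := by
      rw [← Real.exp_one_pow]
      exact pow_lt_pow_left₀ Real.exp_one_lt_d9 (Real.exp_pos _).le (by norm_num)
    norm_num at h
    linarith
  nlinarith

open Polynomial in
theorem exists_poly_with_huge_binomial_multiple (d : ℕ) (hd : 841 ≤ d) :
    ∃ f : Polynomial ℤ, f ≠ 0 ∧
      (f.natDegree : ℝ) ≤ (d : ℝ) * Real.log d ∧
      (∀ i, (|f.coeff i| : ℝ) ≤ Real.exp (2 * d * Real.log d)) ∧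
      (∃ m : ℕ, 0 < m ∧ ∃ a : ℚ, f.map (Int.castRingHom ℚ) ∣ X ^ m - C a) ∧
      (∀ (m : ℕ) (a : ℚ), 0 < m → f.map (Int.castRingHom ℚ) ∣ X ^ m - C a →
        Real.exp (Real.sqrt d) < (m : ℝ) ∧
        (2 : ℝ) ^ Real.exp (Real.sqrt d) < max |(a.num : ℝ)| (a.den : ℝ)) := by
  set k := Nat.sqrt d + 1 with hk
  have hk29 : 29 ≤ k := (Nat.le_sqrt.2 (by lia : 29 * 29 ≤ d)).trans (Nat.le_succ _)
  set g := cyclotomicProd (2 * k) with hg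
  have hdeg : (g.natDegree : ℝ) ≤ d * Real.log d := by
    refine le_trans ?_ (two_mul_sq_le_mul_log hd)
    exact_mod_cast cyclotomicProd.natDegree_le k
  refine ⟨g.scaleRoots 2, scaleRoots_ne_zero (cyclotomicProd.monic _).ne_zero _, ?_, ?_,
    ⟨_, Nat.factorial_pos _, _, scaleRoots_cyclotomicProd_dvd (2 * k)⟩, ?_⟩
  · rwa [natDegree_scaleRoots]
  · intro i
    have he : (2 : ℝ) ≤ Real.exp 1 := Real.exp_one_gt_two.le
    calc |((g.scaleRoots 2).coeff i : ℝ)|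
        = |(g.coeff i : ℝ)| * 2 ^ (g.natDegree - i) := by
          rw [coeff_scaleRoots]; simp [abs_mul]
      _ ≤ 2 ^ g.natDegree * 2 ^ g.natDegree :=
          mul_le_mul (cyclotomicProd.abs_coeff_le _ _)
            (pow_le_pow_right₀ one_le_two (Nat.sub_le _ _)) (by positivity) (by positivity)
      _ ≤ Real.exp 1 ^ g.natDegree * Real.exp 1 ^ g.natDegree := by gcongr
      _ = Real.exp (g.natDegree + g.natDegree) := by rw [Real.exp_one_pow, Real.exp_add]
      _ ≤ Real.exp (2 * d * Real.log d) := Real.exp_le_exp.2 (by linarith)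
  · intro m a hm h
    obtain ⟨ha, hdvd⟩ := eq_two_pow_and_dvd_of_scaleRoots_dvd (by lia) h
    have hsqrt : Real.sqrt d ≤ k := by
      exact_mod_cast Real.real_sqrt_le_nat_sqrt_succ (a := d)
    have hm' : Real.exp (Real.sqrt d) < m :=
      calc Real.exp (Real.sqrt d) ≤ Real.exp k := Real.exp_le_exp.2 hsqrt
        _ < k.centralBinom := exp_lt_centralBinom hk29
        _ ≤ m := by
          exact_mod_cast Nat.le_of_dvd hm (centralBinom_dvd_of_forall_dvd (by lia) hdvd)
    refine ⟨hm', lt_max_of_lt_left ?_⟩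
    have hnum : a.num = 2 ^ m := by
      rw [ha, Rat.num_pow]; rfl
    calc (2 : ℝ) ^ Real.exp (Real.sqrt d) < 2 ^ (m : ℝ) :=
          Real.rpow_lt_rpow_of_exponent_lt one_lt_two hm'
      _ = |(a.num : ℝ)| := by rw [hnum, Real.rpow_natCast]; simp
end

section
/- Let h ∈ ℚ[x] be a nonzero polynomial with nonzero constant coefficient and with at most t nonzero coefficients, where t ≥ 1. Then for every nonconstant irreducible polynomial p ∈ ℚ[x], p^t does not divide h; equivalently, the multiplicity of every irreducible factor of h is at most t − 1. -/
namespace Polynomial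

/-- The Euler-type operator `h ↦ X * h' - n * h` kills exactly the coefficient of degree `n`. -/
theorem support_X_mul_derivative_sub {K : Type*} [Field K] [CharZero K] (h : K[X]) (n : ℕ) :
    (X * derivative h - C (n : K) * h).support = h.support.erase n := by
  ext i
  have hc : (X * derivative h - C (n : K) * h).coeff i = ((i : K) - n) * h.coeff i := by
    cases i with
    | zero => simp
    | succ i => simp [coeff_X_mul, coeff_derivative]; ring
  rw [mem_support_iff, hc]
  simp [sub_eq_zero]

/-- A polynomial with at most `t` terms divisible by the `t`-th power of a prime not dividing `X`
vanishes. -/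
theorem eq_zero_of_prime_pow_dvd_of_card_support_le {K : Type*} [Field K] [CharZero K]
    {p : K[X]} (hp : Prime p) (hpX : ¬ p ∣ X) {t : ℕ} {h : K[X]}
    (hcard : h.support.card ≤ t) (hdvd : p ^ t ∣ h) : h = 0 := by
  induction t generalizing h with
  | zero => exact card_support_eq_zero.mp (Nat.le_zero.mp hcard)
  | succ t ih =>
    by_contra hne
    have hmem := natDegree_mem_support_of_nonzero hne
    have hsupp := support_X_mul_derivative_sub h h.natDegree
    have hg : X * derivative h - C (h.natDegree : K) * h = 0 := by
      refine ih ?_ (dvd_sub (dvd_mul_of_dvd_right ?_ _) (dvd_mul_of_dvd_right ?_ _))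
      · rw [hsupp, Finset.card_erase_of_mem hmem]
        omega
      · simpa only [Nat.add_sub_cancel] using pow_sub_one_dvd_derivative_of_pow_dvd hdvd
      · exact (pow_dvd_pow p t.le_succ).trans hdvd
    rw [hg, support_zero, eq_comm, Finset.erase_eq_empty_iff] at hsupp
    have hone : h.support.card ≤ 1 := by
      rcases hsupp with hs | hs <;> simp [hs]
    have hpm : p ∣ C h.leadingCoeff * X ^ h.natDegree := by
      rw [C_mul_X_pow_eq_self hone]
      exact (dvd_pow_self p t.succ_ne_zero).trans hdvd
    rcases hp.dvd_or_dvd hpm with hC | hX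
    · exact hp.not_isUnit (isUnit_of_dvd_unit hC
        (isUnit_C.mpr (isUnit_iff_ne_zero.mpr (leadingCoeff_ne_zero.mpr hne))))
    · exact hpX (hp.dvd_of_dvd_pow hX)

end Polynomial

open Polynomial in
theorem sparse_nonoriginal_multiplicity_bound (t : ℕ) (ht : 1 ≤ t)
    (h : Polynomial ℚ) (hne : h ≠ 0) (h0 : h.coeff 0 ≠ 0)
    (hsp : h.support.card ≤ t)
    (p : Polynomial ℚ) (hp : Irreducible p) (hpdeg : 0 < p.natDegree) :
    ¬ (p ^ t ∣ h) := by
  intro hdvd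
  refine hne (eq_zero_of_prime_pow_dvd_of_card_support_le hp.prime (fun hpX => h0 ?_) hsp hdvd)
  have hXp : X ∣ p := hp.dvd_symm irreducible_X hpX
  exact X_dvd_iff.mp (hXp.trans ((dvd_pow_self p (by omega)).trans hdvd))
end

section
/- Let F_q be a finite field, e ≥ 1, and let a ∈ F_{q^e} be a nonzero element whose multiplicative order o_a satisfies o_a ≥ t, where t ≥ 2. Let f_{a,t} ∈ F_q[x] be the product of the distinct minimal polynomials over F_q of the elements 1, a, a², …, a^{t−1}. Then x^{o_a} − 1 is a multiple of f_{a,t} with at most t nonzero coefficients, and every nonzero multiple of f_{a,t} in F_q[x] with at most t nonzero coefficients has degree at least o_a; that is, x^{o_a} − 1 is a least-degree t-sparse multiple of f_{a,t}. -/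
namespace Polynomial

theorem card_support_X_pow_sub_one_le {R : Type*} [Ring R] (n : ℕ) :
    ((X : R[X]) ^ n - 1).support.card ≤ 2 := by
  have h : (X : R[X]) ^ n - 1 = C 1 * X ^ n + C (-1) * X ^ 0 := by
    simp [sub_eq_add_neg]
  rw [h]
  exact (Finset.card_le_card (support_binomial_subset n 0 1 (-1))).trans Finset.card_le_two

/-- Distinct minimal polynomials are coprime, so their product divides every polynomial that
vanishes at all the given elements. -/
theorem prod_image_minpoly_dvd {F E ι : Type*} [Field F] [DecidableEq F[X]] [Field E] [Algebra F E]
    [Algebra.IsIntegral F E] (s : Finset ι) (v : ι → E) {g : F[X]}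
    (hg : ∀ i ∈ s, aeval (v i) g = 0) :
    (s.image fun i => minpoly F (v i)).prod id ∣ g := by
  apply Finset.prod_dvd_of_coprime
  · intro p hp r hr hpr
    simp only [Finset.coe_image, Set.mem_image] at hp hr
    obtain ⟨i, -, rfl⟩ := hp
    obtain ⟨j, -, rfl⟩ := hr
    have hi := Algebra.IsIntegral.isIntegral (R := F) (v i)
    have hj := Algebra.IsIntegral.isIntegral (R := F) (v j)
    refine ((minpoly.irreducible hi).isCoprime_or_dvd (minpoly F (v j))).resolve_right fun hd => ?_
    exact hpr (eq_of_monic_of_associated (minpoly.monic hi) (minpoly.monic hj)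
      ((minpoly.irreducible hi).associated_of_dvd (minpoly.irreducible hj) hd))
  · intro p hp
    obtain ⟨i, hi, rfl⟩ := Finset.mem_image.1 hp
    exact minpoly.dvd F (v i) (hg i hi)

/-- A polynomial with at most `t` terms and degree below the order of `a` that vanishes at
`1, a, …, a ^ (t - 1)` is zero. -/
theorem eq_zero_of_forall_aeval_pow_eq_zero {F E : Type*} [Field F] [Field E] [Algebra F E]
    {a : E} {t : ℕ} {h : F[X]} (hdeg : h.natDegree < orderOf a) (hcard : h.support.card ≤ t)
    (hroot : ∀ i < t, aeval (a ^ i) h = 0) : h = 0 := by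
  let ε := h.support.equivFin.symm
  have hinj : Function.Injective fun k => a ^ (ε k : ℕ) := by
    intro k l hkl
    have hlt : ∀ k, (ε k : ℕ) < orderOf a := fun k =>
      (le_natDegree_of_mem_supp _ (ε k).2).trans_lt hdeg
    exact ε.injective (Subtype.ext (pow_injOn_Iio_orderOf (hlt k) (hlt l) hkl))
  have hzero : (fun k => algebraMap F E (h.coeff (ε k))) = 0 := by
    refine Matrix.eq_zero_of_forall_pow_sum_mul_pow_eq_zero hinj fun i => ?_
    have hi := hroot i (i.2.trans_le hcard)
    rw [aeval_def, eval₂_eq_sum, Polynomial.sum, ← Finset.sum_coe_sort, ← ε.sum_comp] at hi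
    simpa only [pow_right_comm a (i : ℕ)] using hi
  by_contra hne
  have hmem := natDegree_mem_support_of_nonzero hne
  have := congrFun hzero (ε.symm ⟨_, hmem⟩)
  simp at this
  exact hne this

end Polynomial

open Polynomial in
theorem least_degree_sparse_multiple_order_polynomial
    (F E : Type*) [Field F] [Fintype F] [DecidableEq (Polynomial F)]
    [Field E] [Finite E] [Algebra F E]
    (a : E) (ha : a ≠ 0) (t : ℕ) (ht : 2 ≤ t) (hord : t ≤ orderOf a)
    (f : Polynomial F)
    (hf : f = ((Finset.range t).image fun i => minpoly F (a ^ i)).prod id) :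
    f ∣ X ^ orderOf a - 1 ∧
    ((X : Polynomial F) ^ orderOf a - 1).support.card ≤ t ∧
    ∀ h : Polynomial F, h ≠ 0 → f ∣ h → h.support.card ≤ t →
      orderOf a ≤ h.natDegree := by
  subst hf
  refine ⟨prod_image_minpoly_dvd _ _ fun i _ => ?_,
    (card_support_X_pow_sub_one_le _).trans ht, fun h h0 hdvd hcard => ?_⟩
  · simp [pow_right_comm a i, pow_orderOf_eq_one]
  · by_contra! hlt
    refine h0 (eq_zero_of_forall_aeval_pow_eq_zero hlt hcard fun i hi => ?_)
    have hmem := Finset.mem_image_of_mem (fun i => minpoly F (a ^ i)) (Finset.mem_range.2 hi)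
    exact (minpoly.dvd_iff).1 ((Finset.dvd_prod_of_mem id hmem).trans hdvd)
end

section
/- Let f ∈ F_q[x] be a monic irreducible polynomial of degree d ≥ 2, let a be a root of f in the extension field F_{q^d}, and let o be the multiplicative order of a. Then the least positive integer n such that f divides x^n − β for some β ∈ F_q is n = o / gcd(o, q − 1); moreover for this n one may take β = a^n, which lies in F_q. -/
open Polynomial in
/-- The image of a finite field `F` in an extension field is the set of fixed points of
`x ↦ x ^ #F`. -/
theorem FiniteField.exists_algebraMap_eq_iff_pow_card_eq
    {F E : Type*} [Field F] [Fintype F] [Field E] [Algebra F E] (x : E) :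
    (∃ y : F, algebraMap F E y = x) ↔ x ^ Fintype.card F = x := by
  refine ⟨?_, fun hx => ?_⟩
  · rintro ⟨y, rfl⟩
    rw [← map_pow, FiniteField.pow_card]
  · have h : aeval x (∏ y : F, (X - C y)) = 0 := by
      have hq : 1 < Fintype.card F := Fintype.one_lt_card
      have hprod : ∏ y : F, (X - C y) = X ^ Fintype.card F - X := by
        have := prod_multiset_X_sub_C_of_monic_of_roots_card_eq
          (p := (X ^ Fintype.card F - X : F[X]))
          (monic_X_pow_sub (by simpa [degree_X] using hq))
          (by rw [FiniteField.roots_X_pow_card_sub_X, FiniteField.X_pow_card_sub_X_natDegree_eq F hq]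
              rfl)
        rwa [FiniteField.roots_X_pow_card_sub_X] at this
      rw [hprod]
      simp [hx]
    rw [map_prod, Finset.prod_eq_zero_iff] at h
    obtain ⟨y, -, hy⟩ := h
    exact ⟨y, by simpa [sub_eq_zero, eq_comm (a := x)] using hy⟩

/-- A power of a nonzero `a` lies in the finite subfield `F` exactly when the exponent is divisible
by `orderOf a / gcd (orderOf a) (#F - 1)`. -/
theorem FiniteField.exists_algebraMap_eq_pow_iff
    {F E : Type*} [Field F] [Fintype F] [Field E] [Algebra F E] {a : E} (ha : a ≠ 0) (n : ℕ) :
    (∃ y : F, algebraMap F E y = a ^ n) ↔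
      orderOf a / (orderOf a).gcd (Fintype.card F - 1) ∣ n := by
  have hq : 1 < Fintype.card F := Fintype.one_lt_card
  have hg : 0 < (orderOf a).gcd (Fintype.card F - 1) := Nat.gcd_pos_of_pos_right _ (by lia)
  have hpow : (a ^ n) ^ Fintype.card F = a ^ n ↔ a ^ (n * (Fintype.card F - 1)) = 1 := by
    obtain ⟨k, hk⟩ : ∃ k, Fintype.card F = k + 1 := ⟨Fintype.card F - 1, by lia⟩
    rw [hk, pow_succ, mul_eq_right₀ (pow_ne_zero n ha), ← pow_mul, Nat.add_sub_cancel]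
  rw [FiniteField.exists_algebraMap_eq_iff_pow_card_eq, hpow, ← orderOf_dvd_iff_pow_eq_one]
  refine ⟨fun h => ?_, fun h => ?_⟩
  · refine (Nat.coprime_div_gcd_div_gcd hg).dvd_of_dvd_mul_right ?_
    rw [← Nat.mul_div_assoc _ (Nat.gcd_dvd_right _ _)]
    exact Nat.div_dvd_div (Nat.gcd_dvd_left _ _) h
  · rw [← Nat.div_mul_cancel (Nat.gcd_dvd_left (orderOf a) (Fintype.card F - 1))]
    exact mul_dvd_mul h (Nat.gcd_dvd_right _ _)

open Polynomial in
theorem least_binomial_multiple_of_irreducible_over_Fq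
    (F E : Type*) [Field F] [Fintype F] [Field E] [Finite E] [Algebra F E]
    (q : ℕ) (hq : q = Fintype.card F)
    (f : Polynomial F) (hmonic : f.Monic) (hirr : Irreducible f)
    (d : ℕ) (hd : f.natDegree = d) (hd2 : 2 ≤ d)
    (hdim : Module.finrank F E = d)
    (a : E) (ha : aeval a f = 0) (o : ℕ) (ho : o = orderOf a) :
    IsLeast {n : ℕ | 0 < n ∧ ∃ β : F, f ∣ X ^ n - C β} (o / Nat.gcd o (q - 1)) ∧
    ∃ β : F, algebraMap F E β = a ^ (o / Nat.gcd o (q - 1)) ∧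
      f ∣ X ^ (o / Nat.gcd o (q - 1)) - C β := by
  subst hq ho
  have hf : f = minpoly F a := minpoly.eq_of_irreducible_of_monic hirr ha hmonic
  have ha0 : a ≠ 0 := by
    rintro rfl
    rw [hf, minpoly.zero, natDegree_X] at hd
    lia
  have hdvd (n : ℕ) (β : F) : f ∣ X ^ n - C β ↔ algebraMap F E β = a ^ n := by
    rw [hf, minpoly.dvd_iff]
    simp [sub_eq_zero, eq_comm (a := a ^ n)]
  have ho : 0 < orderOf a := orderOf_pos_iff.2 (isOfFinOrder_iff_pow_eq_one.2 <| by
    have := Fintype.ofFinite E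
    exact ⟨Fintype.card E - 1, Nat.sub_pos_of_lt Fintype.one_lt_card,
      FiniteField.pow_card_sub_one_eq_one a ha0⟩)
  obtain ⟨β, hβ⟩ := (FiniteField.exists_algebraMap_eq_pow_iff (F := F) ha0 _).2 dvd_rfl
  refine ⟨⟨⟨?_, β, (hdvd _ β).2 hβ⟩, ?_⟩, β, hβ, (hdvd _ β).2 hβ⟩
  · exact Nat.div_pos (Nat.gcd_le_left _ ho) (Nat.gcd_pos_of_pos_left _ ho)
  · rintro n ⟨hn, γ, hγ⟩
    exact Nat.le_of_dvd hn
      ((FiniteField.exists_algebraMap_eq_pow_iff ha0 n).1 ⟨γ, (hdvd n γ).1 hγ⟩)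
end

section
/- Let z₁,…,z_n be distinct integers, let t be an integer, and let w be an integer with 1 ≤ w < n. Let M_w be the (w+1)×(n+1) integer matrix whose column i (for 1 ≤ i ≤ n) is (1, z_i, z_i², …, z_i^{w−1}, z_i^w)ᵀ and whose last column is (0, 0, …, 0, 1, t)ᵀ. Then: (1) every nonzero integer vector v with M_w·v = 0 has at least w+1 nonzero entries; and (2) there exists a nonzero integer vector v with M_w·v = 0 having exactly w+1 nonzero entries if and only if there exist indices i₁ < i₂ < ⋯ < i_w with z_{i₁} + z_{i₂} + ⋯ + z_{i_w} = t. -/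
section AugVandermonde

open Polynomial Matrix Finset

variable {R : Type*} [CommRing R] {n w : ℕ} {z : Fin n → R} {t : R}

/-- The Vandermonde-type matrix whose first `n` columns are `(1, z i, …, z i ^ w)` and whose last
column is `(0, …, 0, 1, t)`. -/
def augVandermonde (z : Fin n → R) (t : R) (w : ℕ) : Matrix (Fin (w + 1)) (Fin (n + 1)) R :=
  Matrix.of fun k => Fin.snoc (α := fun _ => R) (fun i => z i ^ (k : ℕ))
    (if (k : ℕ) = w - 1 then 1 else if (k : ℕ) = w then t else 0)

theorem coeff_vecMul_augVandermonde_castSucc {P : R[X]} (hP : P.natDegree ≤ w) (i : Fin n) :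
    ((fun k : Fin (w + 1) => P.coeff k) ᵥ* augVandermonde z t w) i.castSucc = P.eval (z i) := by
  rw [eval_eq_sum_range' (Nat.lt_succ_of_le hP), ← Fin.sum_univ_eq_sum_range
    (fun k => P.coeff k * z i ^ k)]
  simp [vecMul, dotProduct, augVandermonde]

theorem coeff_vecMul_augVandermonde_last (hw : 1 ≤ w) (P : R[X]) :
    ((fun k : Fin (w + 1) => P.coeff k) ᵥ* augVandermonde z t w) (Fin.last n) =
      P.coeff (w - 1) + P.coeff w * t := by
  obtain ⟨m, rfl⟩ := Nat.exists_eq_add_of_le' hw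
  simp only [vecMul, dotProduct, augVandermonde, of_apply, Fin.snoc_last]
  rw [Fin.sum_univ_castSucc, Fin.sum_univ_castSucc, Finset.sum_eq_zero]
  · simp
  · intro k _
    have := k.2
    simp [this.ne, (this.trans (Nat.lt_succ_self m)).ne]

/-- A null vector of `augVandermonde z t w` annihilates every polynomial of degree at most `w`. -/
theorem sum_eval_mul_add_eq_zero (hw : 1 ≤ w) {v : Fin (n + 1) → R}
    (hv : augVandermonde z t w *ᵥ v = 0) {P : R[X]} (hP : P.natDegree ≤ w) :
    ∑ i, P.eval (z i) * v i.castSucc + (P.coeff (w - 1) + P.coeff w * t) * v (Fin.last n) = 0 := by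
  have h := dotProduct_mulVec (fun k : Fin (w + 1) => P.coeff k) (augVandermonde z t w) v
  rw [hv, dotProduct_zero, dotProduct, Fin.sum_univ_castSucc,
    coeff_vecMul_augVandermonde_last hw] at h
  simpa [coeff_vecMul_augVandermonde_castSucc hP] using h.symm

theorem coeff_nodal_card_sub_one [Nontrivial R] {ι : Type*} (s : Finset ι) (hs : 0 < #s)
    (x : ι → R) : (Lagrange.nodal s x).coeff (#s - 1) = -∑ i ∈ s, x i := by
  rw [Lagrange.nodal_eq, prod_X_sub_C_coeff_card_pred s x hs]

/-- The number of nonzero entries of `v`, split off at the last coordinate. -/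
theorem card_filter_ne_zero_eq [DecidableEq R] (v : Fin (n + 1) → R) :
    #{j | v j ≠ 0} = #{i : Fin n | v i.castSucc ≠ 0} + if v (Fin.last n) ≠ 0 then 1 else 0 := by
  simp only [card_filter, Fin.sum_univ_castSucc]

variable [IsDomain R]

/-- If a nonzero row vector annihilates as many columns of `A` as `A` has rows, then `A` has a
nonzero null vector supported on these columns. -/
theorem exists_mulVec_eq_zero_of_vecMul_eq_zero_on {m κ : Type*} [Fintype m] [DecidableEq m]
    [Fintype κ] [DecidableEq κ] (A : Matrix m κ R) (T : Finset κ)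
    (hT : #T = Fintype.card m) {p : m → R} (hp : p ≠ 0) (hpA : ∀ j ∈ T, (p ᵥ* A) j = 0) :
    ∃ v : κ → R, v ≠ 0 ∧ A *ᵥ v = 0 ∧ ∀ j ∉ T, v j = 0 := by
  let e : m ≃ T := Fintype.equivOfCardEq (by simp [hT])
  have hN : ∃ q ≠ 0, q ᵥ* A.submatrix id (fun i => (e i : κ)) = 0 :=
    ⟨p, hp, funext fun i => hpA _ (e i).2⟩
  obtain ⟨u, hu0, hu⟩ := exists_mulVec_eq_zero_iff.2 (exists_vecMul_eq_zero_iff.1 hN)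
  have hinj : Function.Injective fun i => (e i : κ) := Subtype.val_injective.comp e.injective
  refine ⟨Function.extend (fun i => (e i : κ)) u 0, fun h => hu0 ?_, ?_, fun j hj => ?_⟩
  · rw [← Function.extend_comp hinj u 0, h]
    rfl
  · rw [← hu]
    ext k
    refine (Fintype.sum_of_injective _ hinj _ _ (fun j hj => ?_) fun i => ?_).symm
    · rw [Function.extend_apply' _ _ _ hj, Pi.zero_apply, mul_zero]
    · simp [hinj.extend_apply]
  · refine Function.extend_apply' _ _ _ ?_
    rintro ⟨i, rfl⟩
    exact hj (e i).2

variable [DecidableEq R]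

theorem card_support_of_last_eq_zero (hz : Function.Injective z) (hw : 1 ≤ w)
    {v : Fin (n + 1) → R} (hv0 : v ≠ 0) (hv : augVandermonde z t w *ᵥ v = 0)
    (hlast : v (Fin.last n) = 0) : w + 2 ≤ #{i : Fin n | v i.castSucc ≠ 0} := by
  set S : Finset (Fin n) := {i | v i.castSucc ≠ 0} with hS
  by_contra! hcard
  refine hv0 (funext fun j => ?_)
  refine Fin.lastCases hlast (fun i => ?_) j
  by_contra hi
  have hiS : i ∈ S := by simpa [hS] using hi
  have hdeg : (Lagrange.nodal (S.erase i) z).natDegree ≤ w := by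
    rw [Lagrange.natDegree_nodal, card_erase_of_mem hiS]
    omega
  have h := sum_eval_mul_add_eq_zero hw hv hdeg
  rw [hlast, mul_zero, add_zero, Finset.sum_eq_single i] at h
  · refine mul_ne_zero (Lagrange.eval_nodal_not_at_node fun k hk => ?_) hi h
    exact fun hik => ne_of_mem_erase hk (hz hik).symm
  · intro k _ hki
    by_cases hk : k ∈ S
    · rw [Lagrange.eval_nodal_at_node (mem_erase.2 ⟨hki, hk⟩), zero_mul]
    · rw [show v k.castSucc = 0 by simpa [hS] using hk, mul_zero]
  · simp

theorem card_support_of_last_ne_zero (hw : 1 ≤ w) {v : Fin (n + 1) → R}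
    (hv : augVandermonde z t w *ᵥ v = 0) (hlast : v (Fin.last n) ≠ 0) :
    w ≤ #{i : Fin n | v i.castSucc ≠ 0} := by
  set S : Finset (Fin n) := {i | v i.castSucc ≠ 0} with hS
  by_contra! hcard
  set P : R[X] := Lagrange.nodal S z * X ^ (w - 1 - #S) with hP
  have hmonic : P.Monic := Lagrange.nodal_monic.mul (monic_X_pow _)
  have hdeg : P.natDegree = w - 1 := by
    rw [hP, Lagrange.nodal_monic.natDegree_mul (monic_X_pow _), Lagrange.natDegree_nodal,
      natDegree_X_pow]
    omega
  have h := sum_eval_mul_add_eq_zero hw hv (hdeg.trans_le (Nat.sub_le w 1))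
  have htop : P.coeff (w - 1) = 1 := hdeg ▸ hmonic.coeff_natDegree
  rw [htop, coeff_eq_zero_of_natDegree_lt (by omega : P.natDegree < w), Finset.sum_eq_zero] at h
  · exact hlast (by simpa using h)
  · intro k _
    by_cases hk : k ∈ S
    · simp [hP, Lagrange.eval_nodal_at_node hk]
    · rw [show v k.castSucc = 0 by simpa [hS] using hk, mul_zero]

theorem card_support_of_mulVec_eq_zero (hz : Function.Injective z) (hw : 1 ≤ w)
    {v : Fin (n + 1) → R} (hv0 : v ≠ 0) (hv : augVandermonde z t w *ᵥ v = 0) :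
    w + 1 ≤ #{j | v j ≠ 0} := by
  rw [card_filter_ne_zero_eq]
  by_cases hlast : v (Fin.last n) = 0
  · have := card_support_of_last_eq_zero hz hw hv0 hv hlast
    omega
  · have := card_support_of_last_ne_zero hw hv hlast
    rw [if_pos hlast]
    omega

theorem exists_sum_eq_of_card_support (hz : Function.Injective z) (hw : 1 ≤ w)
    {v : Fin (n + 1) → R} (hv0 : v ≠ 0) (hv : augVandermonde z t w *ᵥ v = 0)
    (hcard : #{j | v j ≠ 0} = w + 1) : ∃ S : Finset (Fin n), #S = w ∧ ∑ i ∈ S, z i = t := by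
  rw [card_filter_ne_zero_eq] at hcard
  have hlast : v (Fin.last n) ≠ 0 := fun hlast => by
    have := card_support_of_last_eq_zero hz hw hv0 hv hlast
    omega
  rw [if_pos hlast, Nat.add_right_cancel_iff] at hcard
  set S : Finset (Fin n) := {i | v i.castSucc ≠ 0} with hS
  refine ⟨S, hcard, ?_⟩
  have hdeg : (Lagrange.nodal S z).natDegree = w := Lagrange.natDegree_nodal.trans hcard
  have h := sum_eval_mul_add_eq_zero hw hv hdeg.le
  have htop : (Lagrange.nodal S z).coeff w = 1 := by
    simpa only [hdeg] using (Lagrange.nodal_monic (s := S) (v := z)).coeff_natDegree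
  have hpred : (Lagrange.nodal S z).coeff (w - 1) = -∑ i ∈ S, z i := by
    simpa only [hcard] using coeff_nodal_card_sub_one S (by omega) z
  rw [htop, hpred, Finset.sum_eq_zero, zero_add, mul_eq_zero, or_iff_left hlast] at h
  · linear_combination -h
  · intro k _
    by_cases hk : k ∈ S
    · rw [Lagrange.eval_nodal_at_node hk, zero_mul]
    · rw [show v k.castSucc = 0 by simpa [hS] using hk, mul_zero]

theorem exists_card_support_of_sum_eq (hz : Function.Injective z) (hw : 1 ≤ w)
    {S : Finset (Fin n)} (hS : #S = w) (hsum : ∑ i ∈ S, z i = t) :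
    ∃ v : Fin (n + 1) → R, v ≠ 0 ∧ augVandermonde z t w *ᵥ v = 0 ∧ #{j | v j ≠ 0} = w + 1 := by
  have hdeg : (Lagrange.nodal S z).natDegree = w := Lagrange.natDegree_nodal.trans hS
  have htop : (Lagrange.nodal S z).coeff w = 1 := by
    simpa only [hdeg] using (Lagrange.nodal_monic (s := S) (v := z)).coeff_natDegree
  have hpred : (Lagrange.nodal S z).coeff (w - 1) = -∑ i ∈ S, z i := by
    simpa only [hS] using coeff_nodal_card_sub_one S (by omega) z
  have hT : #(insert (Fin.last n) (S.map Fin.castSuccEmb)) = w + 1 := by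
    rw [card_insert_of_notMem (by simp [Fin.castSucc_ne_last]), card_map, hS]
  obtain ⟨v, hv0, hv, hsupp⟩ := exists_mulVec_eq_zero_of_vecMul_eq_zero_on
    (augVandermonde z t w) (insert (Fin.last n) (S.map Fin.castSuccEmb)) (by simpa using hT)
    (p := fun k => (Lagrange.nodal S z).coeff k)
    (fun h => one_ne_zero (htop.symm.trans (congrFun h (Fin.last w)))) (by
      intro j hj
      rw [mem_insert, mem_map] at hj
      rcases hj with rfl | ⟨i, hi, rfl⟩
      · rw [coeff_vecMul_augVandermonde_last hw, htop, hpred, hsum]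
        ring
      · exact (coeff_vecMul_augVandermonde_castSucc hdeg.le i).trans
          (Lagrange.eval_nodal_at_node hi))
  refine ⟨v, hv0, hv, le_antisymm (hT ▸ card_le_card fun j hj => ?_)
    (card_support_of_mulVec_eq_zero hz hw hv0 hv)⟩
  by_contra hjT
  exact (mem_filter.1 hj).2 (hsupp j hjT)

end AugVandermonde

theorem sparse_null_vector_iff_subset_sum
    (n : ℕ) (z : Fin n → ℤ) (hz : Function.Injective z)
    (t : ℤ) (w : ℕ) (hw1 : 1 ≤ w) (hwn : w < n)
    (M : Matrix (Fin (w + 1)) (Fin (n + 1)) ℤ)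
    (hM : ∀ (k : Fin (w + 1)) (j : Fin (n + 1)),
      M k j = if h : (j : ℕ) < n then z ⟨j, h⟩ ^ (k : ℕ)
        else if (k : ℕ) = w - 1 then 1 else if (k : ℕ) = w then t else 0) :
    (∀ v : Fin (n + 1) → ℤ, v ≠ 0 → M.mulVec v = 0 →
      w + 1 ≤ (Finset.univ.filter fun j => v j ≠ 0).card) ∧
    ((∃ v : Fin (n + 1) → ℤ, v ≠ 0 ∧ M.mulVec v = 0 ∧
        (Finset.univ.filter fun j => v j ≠ 0).card = w + 1) ↔
      ∃ S : Finset (Fin n), S.card = w ∧ ∑ i ∈ S, z i = t) := by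
  have hMA : M = augVandermonde z t w := by
    ext k j
    rw [hM]
    refine Fin.lastCases ?_ (fun i => ?_) j <;> simp [augVandermonde]
  subst hMA
  refine ⟨fun v hv0 hv => card_support_of_mulVec_eq_zero hz hw1 hv0 hv, ?_, ?_⟩
  · rintro ⟨v, hv0, hv, hcard⟩
    exact exists_sum_eq_of_card_support hz hw1 hv0 hv hcard
  · rintro ⟨S, hS, hsum⟩
    exact exists_card_support_of_sum_eq hz hw1 hS hsum
end

section
/- Let f ∈ F_q[x] be squarefree with nonzero constant coefficient, with monic irreducible factorization f = f₁·f₂⋯f_ℓ, and fix a root a_i of f_i in a fixed algebraic closure of F_q for each i. Then for every positive integer n, there exists b ∈ F_q with f dividing x^n − b if and only if a_i^n = a_j^n for all 1 ≤ i, j ≤ ℓ and a₁^n lies in F_q (i.e., a₁^{n(q−1)} = 1). -/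
open Polynomial in
/-- A root of `X ^ #F - X` in an extension domain of a finite field `F` lies in `F`. -/
theorem exists_algebraMap_eq_of_pow_card_eq {F K : Type*} [Field F] [Fintype F] [CommRing K]
    [IsDomain K] [Algebra F K] {c : K} (hc : c ^ Fintype.card F = c) :
    ∃ b : F, algebraMap F K b = c := by
  have hsplits : (X ^ Fintype.card F - X : F[X]).Splits := by
    simpa using (FiniteField.isSplittingField_sub F F).splits
  exact hsplits.mem_range_of_isRoot (FiniteField.X_pow_card_sub_X_ne_zero F Fintype.one_lt_card)
    (by simp [hc])

/-- The factors of a squarefree product of irreducible elements are pairwise coprime. -/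
theorem pairwise_isCoprime_of_squarefree_prod {R ι : Type*} [CommRing R] [IsPrincipalIdealRing R]
    [IsDomain R] [Fintype ι] {f : ι → R} (hirr : ∀ i, Irreducible (f i))
    (hsf : Squarefree (∏ i, f i)) : Pairwise (Function.onFun IsCoprime f) := by
  classical
  intro i j hij
  refine ((hirr i).coprime_iff_not_dvd).2 fun hdvd => (hirr i).not_isUnit (hsf _ ?_)
  rw [← Finset.mul_prod_erase _ _ (Finset.mem_univ i)]
  exact mul_dvd_mul_left _ (hdvd.trans
    (Finset.dvd_prod_of_mem f (Finset.mem_erase.2 ⟨hij.symm, Finset.mem_univ j⟩)))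

open Polynomial in
theorem binomial_multiple_iff_root_powers
    (F : Type*) [Field F] [Fintype F] (q : ℕ) (hq : q = Fintype.card F)
    (ℓ : ℕ) (hℓ : 0 < ℓ) (fs : Fin ℓ → Polynomial F)
    (hmon : ∀ i, (fs i).Monic) (hirr : ∀ i, Irreducible (fs i))
    (f : Polynomial F) (hf : f = ∏ i, fs i) (hsf : Squarefree f)
    (hf0 : f.coeff 0 ≠ 0)
    (a : Fin ℓ → AlgebraicClosure F) (ha : ∀ i, aeval (a i) (fs i) = 0) :
    ∀ n : ℕ, 0 < n →
      ((∃ b : F, f ∣ X ^ n - C b) ↔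
        ((∀ i j, a i ^ n = a j ^ n) ∧ a ⟨0, hℓ⟩ ^ (n * (q - 1)) = 1)) := by
  intro n _
  have hdvd (i) : fs i ∣ f := hf ▸ Finset.dvd_prod_of_mem fs (Finset.mem_univ i)
  have ha0 (i) : a i ≠ 0 := by
    intro h0
    have h := aeval_eq_zero_of_dvd_aeval_eq_zero (hdvd i) (ha i)
    rw [h0, ← coeff_zero_eq_aeval_zero', map_eq_zero] at h
    exact hf0 h
  constructor
  · rintro ⟨b, hb⟩
    have hroot (i) : a i ^ n = algebraMap F (AlgebraicClosure F) b := by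
      simpa [sub_eq_zero] using
        aeval_eq_zero_of_dvd_aeval_eq_zero ((hdvd i).trans hb) (ha i)
    refine ⟨fun i j => (hroot i).trans (hroot j).symm, ?_⟩
    have hb0 : b ≠ 0 := by
      rintro rfl
      exact pow_ne_zero n (ha0 ⟨0, hℓ⟩) (by simpa using hroot ⟨0, hℓ⟩)
    rw [pow_mul, hroot, ← map_pow, hq, FiniteField.pow_card_sub_one_eq_one b hb0, map_one]
  · rintro ⟨heq, hone⟩
    obtain ⟨b, hb⟩ : ∃ b : F, algebraMap F (AlgebraicClosure F) b = a ⟨0, hℓ⟩ ^ n := by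
      apply exists_algebraMap_eq_of_pow_card_eq
      rw [← Nat.sub_add_cancel (Fintype.card_pos (α := F)), pow_succ, ← pow_mul, ← hq, hone,
        one_mul]
    refine ⟨b, ?_⟩
    subst hf
    refine Fintype.prod_dvd_of_coprime (pairwise_isCoprime_of_squarefree_prod hirr hsf)
      fun i => ?_
    rw [minpoly.eq_of_irreducible_of_monic (hirr i) (ha i) (hmon i)]
    exact minpoly.dvd _ _ (by simp [hb, heq i ⟨0, hℓ⟩])
end

section
/- Let F_q be a finite field of characteristic p, and let f = f₁^{e₁}·f₂^{e₂}⋯f_ℓ^{e_ℓ} ∈ F_q[x] with distinct monic irreducible factors f_i and nonzero constant coefficient. Suppose there is a positive integer n and b ∈ F_q such that the squarefree part f₁⋯f_ℓ divides x^n − b, with n minimal among all such pairs. Let e be the least nonnegative integer with p^e ≥ max_i e_i. Then (x^n − b)^{p^e} = x^{n·p^e} − b^{p^e} is a binomial multiple of f, and every binomial multiple x^N − c of f (N a positive integer, c ∈ F_q) satisfies N ≥ n·p^e; that is, the least-degree binomial multiple of f has degree n·p^e. -/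
open Polynomial in
/-- In characteristic `p`, raising a binomial to the power `p ^ k` gives a binomial. -/
theorem X_pow_sub_C_pow_char_pow {R : Type*} [CommRing R] (p : ℕ) [Fact p.Prime] [CharP R p]
    (m k : ℕ) (a : R) :
    ((X : R[X]) ^ m - C a) ^ p ^ k = X ^ (m * p ^ k) - C (a ^ p ^ k) := by
  rw [sub_pow_char_pow, ← pow_mul, C_pow]

theorem Squarefree.le_of_pow_dvd_pow {M : Type*} [CommMonoidWithZero M] [IsCancelMulZero M]
    {q g : M} (hg : Squarefree g) (hq : Prime q) {i k : ℕ} (h : q ^ i ∣ g ^ k) : i ≤ k := by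
  have h1 : emultiplicity q g ≤ 1 :=
    ((squarefree_iff_emultiplicity_le_one g).1 hg q).resolve_right hq.not_isUnit
  have h2 : (i : ℕ∞) ≤ k * emultiplicity q g := by
    rw [← emultiplicity_pow hq]
    exact le_emultiplicity_of_pow_dvd h
  exact_mod_cast h2.trans ((mul_le_mul_right h1 _).trans_eq (mul_one _))

open Polynomial in
/-- Over a perfect field of characteristic `p`, a binomial with nonzero constant term is a
`p ^ a`-th power of a squarefree binomial. -/
theorem exists_squarefree_X_pow_sub_C_pow_eq {F : Type*} [Field F] (p : ℕ) [Fact p.Prime]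
    [CharP F p] [PerfectRing F p] {N : ℕ} (hN : 0 < N) {c : F} (hc : c ≠ 0) :
    ∃ (a m : ℕ) (d : F), 0 < m ∧ N = m * p ^ a ∧ Squarefree ((X : F[X]) ^ m - C d) ∧
      (X : F[X]) ^ N - C c = (X ^ m - C d) ^ p ^ a := by
  have hp : p.Prime := Fact.out
  obtain ⟨a, m, hm, rfl⟩ := Nat.exists_eq_pow_mul_and_not_dvd hN.ne' p hp.ne_one
  obtain ⟨d, rfl⟩ := (bijective_iterateFrobenius F p a).2 c
  rw [iterateFrobenius_def] at hc ⊢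
  have hd : d ≠ 0 := by
    rintro rfl
    exact hc (zero_pow (pow_pos hp.pos a).ne')
  have hm' : (m : F) ≠ 0 := fun h => hm ((CharP.cast_eq_zero_iff F p m).1 h)
  refine ⟨a, m, d, Nat.pos_of_mul_pos_left hN, mul_comm _ _,
    (separable_X_pow_sub_C d hm' hd).squarefree, ?_⟩
  rw [X_pow_sub_C_pow_char_pow, mul_comm]

open Polynomial in
theorem least_degree_binomial_multiple_with_multiplicities
    (F : Type*) [Field F] [Fintype F] (p : ℕ) [Fact p.Prime] [CharP F p]
    (ℓ : ℕ) (hℓ : 0 < ℓ) (fs : Fin ℓ → Polynomial F)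
    (hmon : ∀ i, (fs i).Monic) (hirr : ∀ i, Irreducible (fs i))
    (hdist : Function.Injective fs)
    (e : Fin ℓ → ℕ) (hepos : ∀ i, 0 < e i)
    (f : Polynomial F) (hf : f = ∏ i, fs i ^ e i) (hf0 : f.coeff 0 ≠ 0)
    (n : ℕ) (b : F)
    (hn : IsLeast {N : ℕ | 0 < N ∧ ∃ c : F, (∏ i, fs i) ∣ X ^ N - C c} n)
    (hb : (∏ i, fs i) ∣ X ^ n - C b)
    (e' : ℕ) (he' : IsLeast {k : ℕ | Finset.univ.sup e ≤ p ^ k} e') :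
    ((X : Polynomial F) ^ n - C b) ^ p ^ e' = X ^ (n * p ^ e') - C (b ^ p ^ e') ∧
    f ∣ X ^ (n * p ^ e') - C (b ^ p ^ e') ∧
    ∀ (N : ℕ) (c : F), 0 < N → f ∣ X ^ N - C c → n * p ^ e' ≤ N := by
  have hp : p.Prime := Fact.out
  have hpow := X_pow_sub_C_pow_char_pow p n e' b
  refine ⟨hpow, ?_, ?_⟩
  · rw [← hpow, hf]
    calc ∏ i, fs i ^ e i ∣ ∏ i, fs i ^ p ^ e' :=
          Finset.prod_dvd_prod_of_dvd _ _ fun i _ =>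
            pow_dvd_pow _ ((Finset.le_sup (Finset.mem_univ i)).trans he'.1)
      _ = (∏ i, fs i) ^ p ^ e' := Finset.prod_pow _ _ _
      _ ∣ _ := pow_dvd_pow_of_dvd hb _
  · intro N c hN hdvd
    have hfac (i : Fin ℓ) : fs i ^ e i ∣ f :=
      hf ▸ Finset.dvd_prod_of_mem (fun j => fs j ^ e j) (Finset.mem_univ i)
    have hfs (i : Fin ℓ) : fs i ∣ f := (dvd_pow_self _ (hepos i).ne').trans (hfac i)
    have hc : c ≠ 0 := by
      rintro rfl
      rw [C_0, sub_zero] at hdvd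
      have hX : fs ⟨0, hℓ⟩ ∣ X := (hirr _).prime.dvd_of_dvd_pow ((hfs _).trans hdvd)
      have hassoc := (hirr ⟨0, hℓ⟩).associated_of_dvd irreducible_X hX
      exact hf0 (X_dvd_iff.1 (hassoc.symm.dvd.trans (hfs _)))
    obtain ⟨a, m, d, hm, rfl, hsq, heq⟩ := exists_squarefree_X_pow_sub_C_pow_eq p hN hc
    rw [heq] at hdvd
    have hea : e' ≤ a := he'.2 <| Finset.sup_le fun i _ =>
      hsq.le_of_pow_dvd_pow (hirr i).prime ((hfac i).trans hdvd)
    have hnm : n ≤ m := by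
      refine hn.2 ⟨hm, d, Finset.prod_dvd_of_coprime (fun i _ j _ hij => ?_) fun i _ =>
        (hirr i).prime.dvd_of_dvd_pow ((hfs i).trans hdvd)⟩
      refine (hirr i).isCoprime_or_dvd (fs j) |>.resolve_right fun h => hij (hdist ?_)
      exact eq_of_monic_of_associated (hmon i) (hmon j) ((hirr i).associated_of_dvd (hirr j) h)
    exact Nat.mul_le_mul hnm (Nat.pow_le_pow_right hp.pos hea)
end
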